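/- Let (id,α) ∈ S_{λ,μ} and let 1 ≤ i ≤ n−1 be such that e_i^{k_i}(α) = 0, where k_i = ⟨λ+ρ, α_i^∨⟩ > 0. Then for every vertex (w,α′) in the connected component of (id,α) in the Φ-graph such that k_i′ := ⟨w(λ+ρ), α_i^∨⟩ > 0, one has e_i^{k_i′}(α′) = 0. -/

import Mathlib

open scoped BigOperators

namespace KFC

/-- A (candidate) root is a pair of 1-based indices. -/
abbrev Root : Type := ℕ × ℕ

/-- A Kostant partition is encoded as a multiplicity function on pairs. -/
abbrev KPf : Type := Root → ℕ

/-- An entry of a signed word: a sign (`true` = '+', `false` = '−') together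
with the root lying under it. -/
abbrev Entry : Type := Bool × Root

/-- `p` is a positive root of type `A_{n-1}`. -/
def IsPos (n : ℕ) (p : Root) : Prop := 1 ≤ p.1 ∧ p.1 < p.2 ∧ p.2 ≤ n

/-- `α` is a genuine Kostant partition for type `A_{n-1}`: it is supported on
positive roots. -/
def IsKP (n : ℕ) (α : KPf) : Prop := ∀ p, α p ≠ 0 → IsPos n p

/-- Add one copy of the root `r`. -/
def KPadd (α : KPf) (r : Root) : KPf := fun p => if p = r then α p + 1 else α p

/-- Remove one copy of the root `r`. -/
def KPsub (α : KPf) (r : Root) : KPf := fun p => if p = r then α p - 1 else α p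

/-- Replace one copy of `r` by one copy of `r'`. -/
def KPmove (α : KPf) (r r' : Root) : KPf := KPadd (KPsub α r) r'

/-- The signed word `W_i` of `α`: roots `(a,b)` ordered by decreasing `a` and,
for equal `a`, increasing `b`; a '+' under each `(h,i)` and a '−' under each
`(h,i+1)`. -/
def Wword (n i : ℕ) (α : KPf) : List Entry :=
  ((List.range (n+1)).reverse).flatMap (fun h =>
    List.replicate (α (h, i)) ((true, (h, i)) : Entry) ++
    List.replicate (α (h, i+1)) ((false, (h, i+1)) : Entry))

/-- The signed word `W_i*` of `α`: roots `(a,b)` ordered by increasing `b` and,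
for equal `b`, decreasing `a`; a '+' under each `(i+1,j)` and a '−' under each
`(i,j)`. -/
def Wstar (n i : ℕ) (α : KPf) : List Entry :=
  (List.range (n+1)).flatMap (fun j =>
    List.replicate (α (i+1, j)) ((true, (i+1, j)) : Entry) ++
    List.replicate (α (i, j)) ((false, (i, j)) : Entry))

/-- One step of the left-to-right reduction: a new '+' cancels the rightmost
surviving '−' (the surviving word always has the shape `+^a −^b`). -/
def redStep (s : List Entry) (e : Entry) : List Entry :=
  match e.1, s.getLast? with
  | true, some (false, _) => s.dropLast
  | _, _ => s ++ [e]

/-- The reduced word (list of surviving entries, in order). -/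
def reduceW (w : List Entry) : List Entry := w.foldl redStep []

def plusCt (w : List Entry) : ℕ := (w.filter (fun e => e.1)).length
def minusCt (w : List Entry) : ℕ := (w.filter (fun e => !e.1)).length

/-- `a_i`: number of '+' in the reduced word of `W_i`. -/
def aSt (n i : ℕ) (α : KPf) : ℕ := plusCt (reduceW (Wword n i α))
/-- `b_i`: number of '−' in the reduced word of `W_i`. -/
def bSt (n i : ℕ) (α : KPf) : ℕ := minusCt (reduceW (Wword n i α))
/-- `a_i*`. -/
def aStar (n i : ℕ) (α : KPf) : ℕ := plusCt (reduceW (Wstar n i α))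
/-- `b_i*`. -/
def bStar (n i : ℕ) (α : KPf) : ℕ := minusCt (reduceW (Wstar n i α))
/-- `u_i`: number of '+' in the reduced word of `W_i* W_i`. -/
def uSt (n i : ℕ) (α : KPf) : ℕ := plusCt (reduceW (Wstar n i α ++ Wword n i α))
/-- `v_i`: number of '−' in the reduced word of `W_i* W_i`. -/
def vSt (n i : ℕ) (α : KPf) : ℕ := minusCt (reduceW (Wstar n i α ++ Wword n i α))

/-- The root under the rightmost surviving '+'. -/
def lastPlus (w : List Entry) : Option Root :=
  (((reduceW w).filter (fun e => e.1)).getLast?).map Prod.snd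

/-- The root under the leftmost surviving '−'. -/
def headMinus (w : List Entry) : Option Root :=
  (((reduceW w).filter (fun e => !e.1)).head?).map Prod.snd

/-- The operator `f̃_i`. -/
def ftilde (n i : ℕ) (α : KPf) : Option KPf :=
  match lastPlus (Wword n i α) with
  | some r => some (KPmove α r (r.1, i+1))
  | none => some (KPadd α (i, i+1))

/-- The operator `ẽ_i`. -/
def etilde (n i : ℕ) (α : KPf) : Option KPf :=
  match headMinus (Wword n i α) with
  | some r => if r = (i, i+1) then some (KPsub α (i, i+1)) else some (KPmove α r (r.1, i))
  | none => none

/-- The operator `f̃_i*`. -/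
def ftildeS (n i : ℕ) (α : KPf) : Option KPf :=
  match lastPlus (Wstar n i α) with
  | some r => some (KPmove α r (i, r.2))
  | none => some (KPadd α (i, i+1))

/-- The operator `ẽ_i*`. -/
def etildeS (n i : ℕ) (α : KPf) : Option KPf :=
  match headMinus (Wstar n i α) with
  | some r => if r = (i, i+1) then some (KPsub α (i, i+1)) else some (KPmove α r (i+1, r.2))
  | none => none

/-- The modified operator `f_i`. -/
def fop (n i : ℕ) (α : KPf) : Option KPf :=
  if bStar n i α < aSt n i α then ftilde n i α
  else if 0 < aStar n i α then ftildeS n i α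
  else none

/-- The modified operator `e_i`. -/
def eop (n i : ℕ) (α : KPf) : Option KPf :=
  if bStar n i α ≤ aSt n i α then
    (if 0 < bSt n i α ∧ headMinus (Wword n i α) ≠ some (i, i+1) then etilde n i α else none)
  else
    (if headMinus (Wstar n i α) ≠ some (i, i+1) then etildeS n i α else none)

/-- The operator `ê_i`. -/
def ehat (n i : ℕ) (α : KPf) : Option KPf :=
  if bStar n i α ≤ aSt n i α then (if 0 < bSt n i α then etilde n i α else none)
  else etildeS n i α

/-- Iterate a partially defined operator (`none` plays the role of `0`). -/
def iterO (g : KPf → Option KPf) : ℕ → KPf → Option KPf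
  | 0, x => some x
  | k+1, x => (g x).bind (iterO g k)

/-- `ε_i(x) = max {k : e_i^k x ≠ 0}`. -/
noncomputable def epsS (n i : ℕ) (x : KPf) : ℕ := sSup {k | iterO (eop n i) k x ≠ none}
/-- `ε̂_i(x) = max {k : ê_i^k x ≠ 0}`. -/
noncomputable def epsHatS (n i : ℕ) (x : KPf) : ℕ := sSup {k | iterO (ehat n i) k x ≠ none}
/-- `φ_i(x) = max {k : f_i^k x ≠ 0}`. -/
noncomputable def phiS (n i : ℕ) (x : KPf) : ℕ := sSup {k | iterO (fop n i) k x ≠ none}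

noncomputable def epsO (n i : ℕ) (o : Option KPf) : ℕ := o.elim 0 (epsS n i)
noncomputable def epsHatO (n i : ℕ) (o : Option KPf) : ℕ := o.elim 0 (epsHatS n i)
noncomputable def phiO (n i : ℕ) (o : Option KPf) : ℕ := o.elim 0 (phiS n i)

/-- `e_l(γ) ≃ 0`. -/
def simZero (n l : ℕ) (γ : KPf) : Prop := eop n l γ ≠ ehat n l γ

/-- `e_l e_m (γ) ≃ 0`. -/
def simZero2 (n l m : ℕ) (γ : KPf) : Prop := ∃ δ, eop n m γ = some δ ∧ simZero n l δ

/-- The box containing all relevant pairs. -/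
def kbox (n : ℕ) : Finset (ℕ × ℕ) := Finset.range (n+1) ×ˢ Finset.range (n+1)

/-- `|α|`: number of parts of the Kostant partition. -/
def kpSize (n : ℕ) (α : KPf) : ℕ := ∑ p ∈ kbox n, α p

/-- The evaluation `ᾱ ∈ ℤ^n` (as a function on 1-based coordinates). -/
def kpEval (n : ℕ) (α : KPf) : ℕ → ℤ :=
  fun k => ∑ p ∈ kbox n, (α p : ℤ) * ((if p.1 = k then 1 else 0) - (if p.2 = k then 1 else 0))

/-- The simple root `α_i = ε_i − ε_{i+1}` as a vector. -/
def srVec (i : ℕ) : ℕ → ℤ := fun k => (if k = i then 1 else 0) - (if k = i+1 then 1 else 0)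

/-- `ρ = (n-1, n-2, …, 1, 0)` (on 1-based coordinates `1..n`). -/
def rhoVec (n : ℕ) : ℕ → ℤ := fun k => (n : ℤ) - k

/-- `⟨γ, α_i^∨⟩ = γ_i − γ_{i+1}`. -/
def pairCo (γ : ℕ → ℤ) (i : ℕ) : ℤ := γ i - γ (i+1)

/-- The permutation of 1-based coordinates induced by `w : Perm (Fin n)`. -/
def extP (n : ℕ) (w : Equiv.Perm (Fin n)) (k : ℕ) : ℕ :=
  if h : 1 ≤ k ∧ k ≤ n then ((w ⟨k - 1, by omega⟩ : Fin n) : ℕ) + 1 else k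

/-- `S_n` acting on `ℤ^n` by permuting coordinates: `(w·v)_k = v_{w⁻¹(k)}`. -/
def permAct (n : ℕ) (w : Equiv.Perm (Fin n)) (v : ℕ → ℤ) : ℕ → ℤ :=
  fun k => v (extP n w⁻¹ k)

/-- The simple transposition `s_i = (i, i+1)` (1-based). -/
def sT (n i : ℕ) : Equiv.Perm (Fin n) :=
  if h : 1 ≤ i ∧ i < n then Equiv.swap ⟨i - 1, by omega⟩ ⟨i, h.2⟩ else 1

/-- Coxeter length = number of inversions. -/
def lenP (n : ℕ) (w : Equiv.Perm (Fin n)) : ℕ :=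
  (Finset.univ.filter (fun p : Fin n × Fin n => p.1 < p.2 ∧ w p.2 < w p.1)).card

/-- The left weak Bruhat order: `u ≤ w` iff `ℓ(w) = ℓ(w u⁻¹) + ℓ(u)`. -/
def leftWeakLE (n : ℕ) (u w : Equiv.Perm (Fin n)) : Prop :=
  lenP n w = lenP n (w * u⁻¹) + lenP n u

/-- `λ + ρ` as a vector. -/
def lamRho (n : ℕ) (lam : ℕ → ℤ) : ℕ → ℤ := fun k => lam k + rhoVec n k

/-- `(w, α) ∈ S_{λ,μ}`, i.e. `ᾱ = w(λ+ρ) − (μ+ρ)`. -/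
def InS (n : ℕ) (lam mu : ℕ → ℤ) (w : Equiv.Perm (Fin n)) (α : KPf) : Prop :=
  IsKP n α ∧ ∀ k, 1 ≤ k → k ≤ n →
    kpEval n α k = permAct n w (lamRho n lam) k - (mu k + rhoVec n k)

/-- A directed edge `(w,α) →^i (s_i w, β)` of the `Φ`-graph. -/
def PhiEdge (n : ℕ) (lam mu : ℕ → ℤ) (v v' : Equiv.Perm (Fin n) × KPf) : Prop :=
  InS n lam mu v.1 v.2 ∧ InS n lam mu v'.1 v'.2 ∧
  ∃ i, 1 ≤ i ∧ i ≤ n - 1 ∧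
    pairCo (permAct n v.1 (lamRho n lam)) i < 0 ∧
    v'.1 = sT n i * v.1 ∧
    iterO (fop n i) (-(pairCo (permAct n v.1 (lamRho n lam)) i)).toNat v.2 = some v'.2

/-- Being in the same connected component of (the underlying undirected graph of)
the `Φ`-graph. -/
def Conn (n : ℕ) (lam mu : ℕ → ℤ) (v v' : Equiv.Perm (Fin n) × KPf) : Prop :=
  Relation.ReflTransGen (fun a b => PhiEdge n lam mu a b ∨ PhiEdge n lam mu b a) v v'

/-- `(w,β)` has a broken hexagon, broken by `Φ_i` after `Φ_j`. -/
def BrokenHexAt (n : ℕ) (lam mu : ℕ → ℤ) (w : Equiv.Perm (Fin n)) (β : KPf) (i j : ℕ) : Prop :=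
  (j = i + 1 ∨ i = j + 1) ∧ 1 ≤ i ∧ i ≤ n - 1 ∧ 1 ≤ j ∧ j ≤ n - 1 ∧
  0 < pairCo (permAct n w (lamRho n lam)) i ∧
  0 < pairCo (permAct n w (lamRho n lam)) j ∧
  iterO (eop n i) (pairCo (permAct n w (lamRho n lam)) i).toNat β ≠ none ∧
  ∃ δ, iterO (eop n j) (pairCo (permAct n w (lamRho n lam)) j).toNat β = some δ ∧
    epsS n i δ < (pairCo (permAct n w (lamRho n lam)) i).toNat +
      (pairCo (permAct n w (lamRho n lam)) j).toNat

/-- `γ` is obtained from `β` by an initial segment of the operator sequence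
(`e_i` applied `ki` times, then `e_j` applied `ki+kj` times, then `e_i` applied
`kj` times). -/
def alongPath (n i j ki kj : ℕ) (β γ : KPf) : Prop :=
  (∃ a ≤ ki, iterO (eop n i) a β = some γ) ∨
  (∃ b ≤ ki + kj, (iterO (eop n i) ki β).bind (iterO (eop n j) b) = some γ) ∨
  (∃ c ≤ kj, ((iterO (eop n i) ki β).bind (iterO (eop n j) (ki + kj))).bind
      (iterO (eop n i) c) = some γ)

/-- Conjecture A: no broken diamonds along the hexagon paths. -/
def ConjA (n : ℕ) (lam mu : ℕ → ℤ) : Prop :=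
  ∀ (w : Equiv.Perm (Fin n)) (β : KPf) (i j : ℕ),
    InS n lam mu w β → 1 ≤ i → i ≤ n - 1 → 1 ≤ j → j ≤ n - 1 → (j = i + 1 ∨ i = j + 1) →
    ∀ ki kj : ℤ,
      ki = pairCo (permAct n w (lamRho n lam)) i →
      kj = pairCo (permAct n w (lamRho n lam)) j →
      0 < ki → 0 < kj →
      iterO (eop n i) ki.toNat β ≠ none → iterO (eop n j) kj.toNat β ≠ none →
      ∀ γ : KPf,
        (alongPath n i j ki.toNat kj.toNat β γ ∨ alongPath n j i kj.toNat ki.toNat β γ) →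
        ¬ (simZero2 n i j γ ∧ simZero2 n j i γ)

/-- Conjecture B: broken hexagons propagate up to the source vertex. -/
def ConjB (n : ℕ) (lam mu : ℕ → ℤ) : Prop :=
  ∀ (w : Equiv.Perm (Fin n)) (β α : KPf) (i j : ℕ),
    InS n lam mu w β → InS n lam mu 1 α → Conn n lam mu (1, α) (w, β) →
    BrokenHexAt n lam mu w β i j → ∃ j', BrokenHexAt n lam mu 1 α i j'

/-- The Kostka–Foulkes polynomial `K_{λ,μ}(t) = Σ_{(w,α) ∈ S_{λ,μ}} sgn(w) t^{|α|}`. -/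
noncomputable def KF (n : ℕ) (lam mu : ℕ → ℤ) : Polynomial ℤ :=
  ∑ᶠ (w : Equiv.Perm (Fin n)) (α : KPf) (_ : InS n lam mu w α),
    ((Equiv.Perm.sign w : ℤ) • (Polynomial.X ^ kpSize n α) : Polynomial ℤ)

end KFC

namespace KFC

/-! ### Tensor products of signed factors -/

section Tensor

variable {A : Type*}

/-- Number of surviving '−' of a tensor product whose factors (last one first) have
signature `+^(φ a) −^(ε a)`. -/
def lmi (φ ε : A → ℕ) : List A → ℕ
  | [] => 0
  | a :: l => ε a + (lmi φ ε l - φ a)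

/-- Number of surviving '+'. -/
def lpl (φ ε : A → ℕ) : List A → ℕ
  | [] => 0
  | a :: l => lpl φ ε l + (φ a - lmi φ ε l)

/-- The factor containing the rightmost surviving '+'. -/
def fpos (φ ε : A → ℕ) : List A → Option A
  | [] => none
  | a :: l => if lmi φ ε l < φ a then some a else fpos φ ε l

/-- The factor containing the leftmost surviving '−'. -/
def epos (φ ε : A → ℕ) : List A → Option A
  | [] => none
  | a :: l => if φ a < lmi φ ε l then epos φ ε l else if 0 < ε a then some a else none

/-- Apply `act` to the factor containing the rightmost surviving '+'. -/
def lf (φ ε : A → ℕ) (act : A → A) : List A → Option (List A)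
  | [] => none
  | a :: l => if lmi φ ε l < φ a then some (act a :: l) else (lf φ ε act l).map (a :: ·)

variable (φ ε : A → ℕ) (act : A → A)

theorem lmi_append (l₂ l₁ : List A) :
    lmi φ ε (l₂ ++ l₁) = lmi φ ε l₂ + (lmi φ ε l₁ - lpl φ ε l₂) := by
  induction l₂ with
  | nil => simp [lmi, lpl]
  | cons a l ih => simp only [List.cons_append, lmi, lpl, ih]; omega

theorem lpl_append (l₂ l₁ : List A) :
    lpl φ ε (l₂ ++ l₁) = lpl φ ε l₁ + (lpl φ ε l₂ - lmi φ ε l₁) := by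
  induction l₂ with
  | nil => simp [lpl]
  | cons a l ih => simp only [List.cons_append, lpl, lmi_append, ih]; omega

theorem fpos_append (l₂ l₁ : List A) :
    fpos φ ε (l₂ ++ l₁) =
      if lmi φ ε l₁ < lpl φ ε l₂ then fpos φ ε l₂ else fpos φ ε l₁ := by
  induction l₂ with
  | nil => simp [lpl]
  | cons a l ih =>
    simp only [List.cons_append, fpos, lpl, lmi_append, ih]
    grind

theorem epos_append (l₂ l₁ : List A) :
    epos φ ε (l₂ ++ l₁) =
      if lpl φ ε l₂ < lmi φ ε l₁ then epos φ ε l₁ else epos φ ε l₂ := by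
  induction l₂ with
  | nil =>
    cases l₁ with
    | nil => simp
    | cons a l =>
      simp only [List.nil_append, epos, lpl, lmi]
      split_ifs <;> first | rfl | omega
  | cons a l ih =>
    simp only [List.cons_append, epos, lpl, lmi_append, ih]
    grind

theorem lf_append (l₂ l₁ : List A) :
    lf φ ε act (l₂ ++ l₁) =
      if lmi φ ε l₁ < lpl φ ε l₂ then (lf φ ε act l₂).map (· ++ l₁)
      else (lf φ ε act l₁).map (l₂ ++ ·) := by
  induction l₂ with
  | nil => simp [lpl]
  | cons a l ih =>
    have e : lpl φ ε (a :: l) = lpl φ ε l + (φ a - lmi φ ε l) := rfl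
    simp only [List.cons_append, lf, lmi_append, ih]
    by_cases h1 : lmi φ ε l₁ < lpl φ ε l
    · have h3 : lmi φ ε l₁ < lpl φ ε (a :: l) := by omega
      by_cases h2 : lmi φ ε l < φ a
      · have h4 : lmi φ ε l + (lmi φ ε l₁ - lpl φ ε l) < φ a := by omega
        simp [h2, h3, h4]
      · have h4 : ¬ lmi φ ε l + (lmi φ ε l₁ - lpl φ ε l) < φ a := by omega
        simp only [h1, h2, h3, h4, if_true, if_false, Option.map_map]; rfl
    · by_cases h4 : lmi φ ε l + (lmi φ ε l₁ - lpl φ ε l) < φ a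
      · have h2 : lmi φ ε l < φ a := by omega
        have h3 : lmi φ ε l₁ < lpl φ ε (a :: l) := by omega
        simp [h2, h3, h4]
      · have h3 : ¬ lmi φ ε l₁ < lpl φ ε (a :: l) := by omega
        simp only [h1, h3, h4, if_false, Option.map_map]; rfl

theorem fpos_eq_none_iff (l : List A) : fpos φ ε l = none ↔ lpl φ ε l = 0 := by
  induction l with
  | nil => simp [fpos, lpl]
  | cons a l ih => simp only [fpos, lpl]; split_ifs <;> simp [ih] <;> omega

theorem epos_eq_none_iff (l : List A) : epos φ ε l = none ↔ lmi φ ε l = 0 := by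
  induction l with
  | nil => simp [epos, lmi]
  | cons a l ih => simp only [epos, lmi]; split_ifs <;> simp [ih] <;> omega

theorem lf_eq_none_iff (l : List A) : lf φ ε act l = none ↔ lpl φ ε l = 0 := by
  induction l with
  | nil => simp [lf, lpl]
  | cons a l ih => simp only [lf, lpl]; split_ifs <;> simp [ih] <;> omega

theorem mem_of_fpos {l : List A} {a : A} (h : fpos φ ε l = some a) : a ∈ l ∧ 0 < φ a := by
  induction l with
  | nil => simp [fpos] at h
  | cons b l ih =>
    simp only [fpos] at h
    split_ifs at h with hb
    · cases h; exact ⟨by simp, by omega⟩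
    · exact ⟨List.mem_cons_of_mem _ (ih h).1, (ih h).2⟩

theorem mem_of_epos {l : List A} {a : A} (h : epos φ ε l = some a) : a ∈ l ∧ 0 < ε a := by
  induction l with
  | nil => simp [epos] at h
  | cons b l ih =>
    simp only [epos] at h
    split_ifs at h with hb hb'
    · exact ⟨List.mem_cons_of_mem _ (ih h).1, (ih h).2⟩
    · cases h; exact ⟨by simp, hb'⟩

theorem lpl_sub_lmi (l : List A) :
    (lpl φ ε l : ℤ) - lmi φ ε l = (l.map fun a => (φ a : ℤ) - ε a).sum := by
  induction l with
  | nil => simp [lpl, lmi]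
  | cons a l ih => simp only [lpl, lmi, List.map_cons, List.sum_cons, ← ih]; omega

variable {φ ε}

theorem lmi_congr {φ' ε' : A → ℕ} {l : List A} (h : ∀ a ∈ l, φ' a = φ a ∧ ε' a = ε a) :
    lmi φ' ε' l = lmi φ ε l := by
  induction l with
  | nil => rfl
  | cons a l ih =>
    simp only [List.mem_cons, forall_eq_or_imp] at h
    simp only [lmi, ih h.2, h.1]

theorem lpl_congr {φ' ε' : A → ℕ} {l : List A} (h : ∀ a ∈ l, φ' a = φ a ∧ ε' a = ε a) :
    lpl φ' ε' l = lpl φ ε l := by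
  induction l with
  | nil => rfl
  | cons a l ih =>
    simp only [List.mem_cons, forall_eq_or_imp] at h
    simp only [lpl, ih h.2, lmi_congr h.2, h.1]

theorem lmi_eq_zero {l : List A} (h : ∀ a ∈ l, φ a = 0 ∧ ε a = 0) : lmi φ ε l = 0 := by
  induction l with
  | nil => rfl
  | cons a l ih =>
    simp only [List.mem_cons, forall_eq_or_imp] at h
    simp [lmi, ih h.2, h.1]

theorem lpl_eq_zero {l : List A} (h : ∀ a ∈ l, φ a = 0 ∧ ε a = 0) : lpl φ ε l = 0 := by
  induction l with
  | nil => rfl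
  | cons a l ih =>
    simp only [List.mem_cons, forall_eq_or_imp] at h
    simp [lpl, ih h.2, h.1]

/-- Moving one '+' to '−' in the factor of the rightmost surviving '+' makes that factor
carry the leftmost surviving '−'. -/
theorem epos_of_fpos {φ' ε' : A → ℕ} {l : List A} {k : A} (hn : l.Nodup)
    (hk : fpos φ ε l = some k) (h1 : φ' k + 1 = φ k) (h2 : ε' k = ε k + 1)
    (h : ∀ a ∈ l, a ≠ k → φ' a = φ a ∧ ε' a = ε a) :
    epos φ' ε' l = some k ∧ lpl φ' ε' l + 1 = lpl φ ε l ∧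
      lmi φ' ε' l = lmi φ ε l + 1 := by
  induction l with
  | nil => simp [fpos] at hk
  | cons a l ih =>
    rw [List.nodup_cons] at hn
    simp only [fpos] at hk
    split_ifs at hk with hb
    · cases hk
      have hl : ∀ b ∈ l, φ' b = φ b ∧ ε' b = ε b := fun b hb' =>
        h b (List.mem_cons_of_mem _ hb') (by rintro rfl; exact hn.1 hb')
      simp only [epos, lpl, lmi, lmi_congr hl, lpl_congr hl, h2]
      rw [if_neg (by omega), if_pos (by omega)]
      exact ⟨rfl, by omega, by omega⟩
    · have hka : a ≠ k := by rintro rfl; exact hn.1 (mem_of_fpos φ ε hk).1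
      obtain ⟨i1, i2, i3⟩ := ih hn.2 hk fun b hb' => h b (List.mem_cons_of_mem _ hb')
      obtain ⟨ha1, ha2⟩ := h a (by simp) hka
      simp only [epos, lpl, lmi, i1, i3, ha1, ha2]
      rw [if_pos (by omega)]
      exact ⟨rfl, by omega, by omega⟩

theorem fpos_of_epos {φ' ε' : A → ℕ} {l : List A} {k : A} (hn : l.Nodup)
    (hk : epos φ ε l = some k) (h1 : φ' k = φ k + 1) (h2 : ε' k + 1 = ε k)
    (h : ∀ a ∈ l, a ≠ k → φ' a = φ a ∧ ε' a = ε a) :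
    fpos φ' ε' l = some k ∧ lmi φ' ε' l + 1 = lmi φ ε l ∧
      lpl φ' ε' l = lpl φ ε l + 1 := by
  induction l with
  | nil => simp [epos] at hk
  | cons a l ih =>
    rw [List.nodup_cons] at hn
    simp only [epos] at hk
    split_ifs at hk with hb hb2
    · have hka : a ≠ k := by rintro rfl; exact hn.1 (mem_of_epos φ ε hk).1
      obtain ⟨i1, i2, i3⟩ := ih hn.2 hk fun b hb' => h b (List.mem_cons_of_mem _ hb')
      obtain ⟨ha1, ha2⟩ := h a (by simp) hka
      simp only [fpos, lmi, lpl, i1, i3, ha1, ha2]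
      rw [if_neg (by omega)]
      exact ⟨rfl, by omega, by omega⟩
    · cases hk
      have hl : ∀ b ∈ l, φ' b = φ b ∧ ε' b = ε b := fun b hb' =>
        h b (List.mem_cons_of_mem _ hb') (by rintro rfl; exact hn.1 hb')
      simp only [fpos, lmi, lpl, lmi_congr hl, lpl_congr hl, h1]
      rw [if_pos (by omega)]
      exact ⟨rfl, by omega, by omega⟩

/-- Adding a '+' to a factor, or removing a '−' from it, either adds a surviving '+' or
removes a surviving '−'. -/
theorem stats_bump {φ' ε' : A → ℕ} {l : List A} {k : A} (hn : l.Nodup) (hk : k ∈ l)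
    (h1 : (φ' k = φ k + 1 ∧ ε' k = ε k) ∨ (φ' k = φ k ∧ ε' k + 1 = ε k))
    (h : ∀ a ∈ l, a ≠ k → φ' a = φ a ∧ ε' a = ε a) :
    (lpl φ' ε' l = lpl φ ε l + 1 ∧ lmi φ' ε' l = lmi φ ε l) ∨
      (lpl φ' ε' l = lpl φ ε l ∧ lmi φ' ε' l + 1 = lmi φ ε l) := by
  induction l with
  | nil => simp at hk
  | cons a l ih =>
    rw [List.nodup_cons] at hn
    by_cases hak : a = k
    · subst hak
      have hl : ∀ b ∈ l, φ' b = φ b ∧ ε' b = ε b := fun b hb' =>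
        h b (List.mem_cons_of_mem _ hb') (by rintro rfl; exact hn.1 hb')
      simp only [lmi, lpl, lmi_congr hl, lpl_congr hl]
      omega
    · have := ih hn.2 ((List.mem_cons.1 hk).resolve_left (Ne.symm hak))
        fun b hb' => h b (List.mem_cons_of_mem _ hb')
      obtain ⟨ha1, ha2⟩ := h a (by simp) hak
      simp only [lpl, lmi, ha1, ha2]
      omega

end Tensor

/-- Iteration of a partial function. -/
def itr {A : Type*} (g : A → Option A) : ℕ → A → Option A
  | 0, x => some x
  | k + 1, x => (g x).bind (itr g k)

theorem itr_add {A : Type*} (g : A → Option A) (a b : ℕ) (x : A) :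
    itr g (a + b) x = (itr g a x).bind (itr g b) := by
  induction a generalizing x with
  | zero => simp [itr]
  | succ a ih =>
    rw [Nat.succ_add]
    simp only [itr]
    cases g x with
    | none => rfl
    | some y => simpa using ih y

theorem iterO_eq_itr (g : KPf → Option KPf) (k : ℕ) (x : KPf) : iterO g k x = itr g k x := by
  induction k generalizing x with
  | zero => rfl
  | succ k ih => simp only [iterO, itr]; congr 1; funext y; exact ih y

theorem itr_bind_comm {A : Type*} {g g' : A → Option A} {P : A → Prop}
    (hP : ∀ x y, P x → g x = some y → P y) (hP' : ∀ x y, P x → g' x = some y → P y)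
    (hc : ∀ x, P x → (g x).bind g' = (g' x).bind g) (a b : ℕ) {x : A} (hx : P x) :
    (itr g a x).bind (itr g' b) = (itr g' b x).bind (itr g a) := by
  have key : ∀ (b : ℕ) (x : A), P x → (g x).bind (itr g' b) = (itr g' b x).bind g := by
    intro b
    induction b with
    | zero => intro x _; simp [itr]
    | succ b ih =>
      intro x hx
      have := hc x hx
      simp only [itr]
      rw [← Option.bind_assoc, this]
      cases h' : g' x with
      | none => rfl
      | some y => simpa using ih y (hP' x y hx h')
  induction a generalizing x with
  | zero => simp [itr]
  | succ a ih =>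
    simp only [itr]
    have h2 := key b x hx
    rw [show (itr g' b x).bind (fun y => (g y).bind (itr g a)) =
      ((itr g' b x).bind g).bind (itr g a) from (Option.bind_assoc _ _ _).symm, ← h2]
    cases h : g x with
    | none => rfl
    | some y => simpa using ih (hP x y hx h)


/-! ### The operators `fop` and `eop` through the tensor product rule -/

/-- A block `+^{x k.1} −^{x k.2}` of a signed word. -/
abbrev Blk : Type := Root × Root

/-- Number of '+' of a block. -/
abbrev bp (x : KPf) (k : Blk) : ℕ := x k.1

/-- Number of '−' of a block. -/
abbrev bm (x : KPf) (k : Blk) : ℕ := x k.2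

/-- The signed word of a list of blocks, last block first. -/
def bword (x : KPf) : List Blk → List Entry
  | [] => []
  | k :: l => bword x l ++
      (List.replicate (x k.1) ((true, k.1) : Entry) ++
        List.replicate (x k.2) ((false, k.2) : Entry))

theorem bword_map (x : KPf) (g : ℕ → Blk) (L : List ℕ) :
    bword x (L.map g) = L.reverse.flatMap fun h =>
      (List.replicate (x (g h).1) ((true, (g h).1) : Entry) ++
        List.replicate (x (g h).2) ((false, (g h).2) : Entry)) := by
  induction L with
  | nil => rfl
  | cons a L ih => simp [bword, ih]

theorem foldl_minus (s : List Entry) (b : ℕ) (r : Root) :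
    (List.replicate b ((false, r) : Entry)).foldl redStep s =
      s ++ List.replicate b (false, r) := by
  induction b generalizing s with
  | zero => simp
  | succ b ih => simp [List.replicate_succ, redStep, ih]

theorem foldl_plus (P M : List Entry) (hP : ∀ e ∈ P, e.1 = true) (hM : ∀ e ∈ M, e.1 = false)
    (a : ℕ) (r : Root) :
    (List.replicate a ((true, r) : Entry)).foldl redStep (P ++ M) =
      P ++ List.replicate (a - M.length) (true, r) ++ M.take (M.length - a) := by
  induction a generalizing P M with
  | zero => simp
  | succ a ih =>
    rw [List.replicate_succ, List.foldl_cons]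
    rcases List.eq_nil_or_concat M with rfl | ⟨M', e, rfl⟩
    · have : redStep (P ++ []) (true, r) = (P ++ [(true, r)]) ++ [] := by
        simp only [redStep, List.append_nil]
        split
        · rename_i h
          have := hP _ (List.mem_of_getLast? h)
          simp at this
        · rfl
      rw [this, ih _ _ (by simpa [or_imp, forall_and] using hP) (by simp)]
      simp [List.replicate_succ]
    · obtain ⟨e1, e2⟩ := e
      have he : e1 = false := hM (e1, e2) (by simp)
      subst he
      have : redStep (P ++ M'.concat (false, e2)) (true, r) = P ++ M' := by
        simp [redStep, ← List.append_assoc]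
      rw [this, ih P M' hP fun e he => hM e (by simp [he])]
      simp only [List.concat_eq_append, List.length_append, List.length_singleton,
        Nat.add_sub_add_right]
      rw [List.take_append_of_le_length (by omega)]

theorem reduceW_bword (x : KPf) (K : List Blk) : ∃ P M : List Entry,
    reduceW (bword x K) = P ++ M ∧ (∀ e ∈ P, e.1 = true) ∧ (∀ e ∈ M, e.1 = false) ∧
    P.length = lpl (bp x) (bm x) K ∧ M.length = lmi (bp x) (bm x) K ∧
    P.getLast?.map Prod.snd = (fpos (bp x) (bm x) K).map Prod.fst ∧
    M.head?.map Prod.snd = (epos (bp x) (bm x) K).map Prod.snd := by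
  induction K with
  | nil => exact ⟨[], [], rfl, by simp, by simp, rfl, rfl, rfl, rfl⟩
  | cons k K ih =>
    obtain ⟨P, M, h, hP, hM, hl, hm, hf, he⟩ := ih
    have hp1 : bp x k = x k.1 := rfl
    have hp2 : bm x k = x k.2 := rfl
    refine ⟨P ++ List.replicate (x k.1 - M.length) (true, k.1),
      M.take (M.length - x k.1) ++ List.replicate (x k.2) (false, k.2), ?_, ?_, ?_, ?_, ?_, ?_, ?_⟩
    · rw [reduceW] at h ⊢
      rw [bword, List.foldl_append, List.foldl_append, h, foldl_plus P M hP hM, foldl_minus,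
        List.append_assoc]
    · intro e
      rw [List.mem_append, List.mem_replicate]
      rintro (h | h)
      · exact hP e h
      · rw [h.2]
    · intro e
      rw [List.mem_append, List.mem_replicate]
      rintro (h | h)
      · exact hM e (List.mem_of_mem_take h)
      · rw [h.2]
    · simp [lpl, hl, hm]
    · simp only [List.length_append, List.length_take, List.length_replicate, lmi, hm]; omega
    · rw [List.getLast?_append, hm]
      simp only [fpos]
      split_ifs with hk
      · rw [List.getLast?_replicate, if_neg (by omega)]; simp
      · rw [List.getLast?_replicate, if_pos (by omega)]; simpa using hf
    · rw [List.head?_append, hm]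
      simp only [epos]
      split_ifs with hk hk2
      · rw [List.head?_take, if_neg (by omega)]
        have : M.head? ≠ none := by
          intro h0; rw [List.head?_eq_none_iff] at h0; subst h0; simp at hm; omega
        cases hh : M.head? with
        | none => exact absurd hh this
        | some e => rw [hh] at he; simpa using he
      · rw [List.head?_take, if_pos (by omega), List.head?_replicate, if_neg (by omega)]; simp
      · rw [List.head?_take, if_pos (by omega), List.head?_replicate, if_pos (by omega)]; simp

theorem filter_all {P M : List Entry} (hP : ∀ e ∈ P, e.1 = true) (hM : ∀ e ∈ M, e.1 = false) :
    (P ++ M).filter (fun e => e.1) = P ∧ (P ++ M).filter (fun e => !e.1) = M := by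
  rw [List.filter_append, List.filter_append]
  refine ⟨?_, ?_⟩
  · rw [(List.filter_eq_self (l := P)).2 hP,
      (List.filter_eq_nil_iff (l := M)).2 (by simpa using hM), List.append_nil]
  · rw [(List.filter_eq_self (l := M)).2 (by simpa using hM),
      (List.filter_eq_nil_iff (l := P)).2 (by simpa using hP), List.nil_append]

theorem bword_stats (x : KPf) (K : List Blk) :
    plusCt (reduceW (bword x K)) = lpl (bp x) (bm x) K ∧
    minusCt (reduceW (bword x K)) = lmi (bp x) (bm x) K ∧
    lastPlus (bword x K) = (fpos (bp x) (bm x) K).map Prod.fst ∧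
    headMinus (bword x K) = (epos (bp x) (bm x) K).map Prod.snd := by
  obtain ⟨P, M, h, hP, hM, hl, hm, hf, he⟩ := reduceW_bword x K
  obtain ⟨h1, h2⟩ := filter_all hP hM
  simp only [plusCt, minusCt, lastPlus, headMinus, h, h1, h2]
  exact ⟨hl, hm, hf, he⟩

/-- Row block of `W_i`. -/
def rowB (i h : ℕ) : Blk := ((h, i), (h, i + 1))

/-- Column block of `W_i*`. -/
def colB (i b : ℕ) : Blk := ((i + 1, b), (i, b))

/-- The blocks of `W_i`, last one first. -/
def blkW (n i : ℕ) : List Blk := (List.range (n + 1)).map (rowB i)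

/-- The blocks of `W_i*`, last one first. -/
def blkS (n i : ℕ) : List Blk := (List.range (n + 1)).reverse.map (colB i)

/-- The blocks of `W_i* W_i`, last one first. -/
def blks (n i : ℕ) : List Blk := blkW n i ++ blkS n i

theorem Wword_eq (n i : ℕ) (x : KPf) : Wword n i x = bword x (blkW n i) := by
  rw [blkW, bword_map]; rfl

theorem Wstar_eq (n i : ℕ) (x : KPf) : Wstar n i x = bword x (blkS n i) := by
  rw [blkS, bword_map, List.reverse_reverse]; rfl

theorem mem_blkW {n i : ℕ} {k : Blk} : k ∈ blkW n i ↔ ∃ h ≤ n, k = rowB i h := by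
  simp [blkW, eq_comm]

theorem mem_blkS {n i : ℕ} {k : Blk} : k ∈ blkS n i ↔ ∃ h ≤ n, k = colB i h := by
  simp [blkS, eq_comm]

theorem fop_eq (n i : ℕ) (x : KPf) :
    fop n i x = (fpos (bp x) (bm x) (blks n i)).map fun k => KPmove x k.1 k.2 := by
  obtain ⟨w1, w2, w3, w4⟩ := bword_stats x (blkW n i)
  obtain ⟨s1, s2, s3, s4⟩ := bword_stats x (blkS n i)
  rw [blks, fpos_append]
  simp only [fop, bStar, aSt, aStar, ftilde, ftildeS, Wword_eq, Wstar_eq, w1, s1, s2, w3, s3]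
  split_ifs with h1 h2
  · cases h : fpos (bp x) (bm x) (blkW n i) with
    | none => rw [fpos_eq_none_iff] at h; omega
    | some k =>
      obtain ⟨h, -, rfl⟩ := mem_blkW.1 (mem_of_fpos _ _ h).1
      rfl
  · cases h : fpos (bp x) (bm x) (blkS n i) with
    | none => rw [fpos_eq_none_iff] at h; omega
    | some k =>
      obtain ⟨h, -, rfl⟩ := mem_blkS.1 (mem_of_fpos _ _ h).1
      rfl
  · rw [(fpos_eq_none_iff _ _ _).2 (by omega)]; rfl

theorem eop_eq (n i : ℕ) (x : KPf) :
    eop n i x = (epos (bp x) (bm x) (blks n i)).bind fun k =>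
      if k.2 = (i, i + 1) then none else some (KPmove x k.2 k.1) := by
  obtain ⟨w1, w2, w3, w4⟩ := bword_stats x (blkW n i)
  obtain ⟨s1, s2, s3, s4⟩ := bword_stats x (blkS n i)
  rw [blks, epos_append]
  simp only [eop, bStar, aSt, bSt, etilde, etildeS, Wword_eq, Wstar_eq, w1, w2, s2, w4, s4]
  by_cases h1 : lmi (bp x) (bm x) (blkS n i) ≤ lpl (bp x) (bm x) (blkW n i)
  · rw [if_pos h1, if_neg (c := lpl (bp x) (bm x) (blkW n i) < lmi (bp x) (bm x) (blkS n i))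
      (by omega)]
    cases h : epos (bp x) (bm x) (blkW n i) with
    | none => simp
    | some k =>
      have hpos : 0 < lmi (bp x) (bm x) (blkW n i) := by
        rw [Nat.pos_iff_ne_zero]; intro h0; rw [(epos_eq_none_iff _ _ _).2 h0] at h; cases h
      obtain ⟨b, -, rfl⟩ := mem_blkW.1 (mem_of_epos _ _ h).1
      by_cases hb : (rowB i b).2 = (i, i + 1)
      · simp [hb]
      · simp [hb, hpos]; rfl
  · rw [if_neg h1, if_pos (c := lpl (bp x) (bm x) (blkW n i) < lmi (bp x) (bm x) (blkS n i))
      (by omega)]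
    cases h : epos (bp x) (bm x) (blkS n i) with
    | none => rw [epos_eq_none_iff] at h; omega
    | some k =>
      obtain ⟨b, -, rfl⟩ := mem_blkS.1 (mem_of_epos _ _ h).1
      by_cases hb : (colB i b).2 = (i, i + 1)
      · simp [hb]
      · simp [hb]; rfl


/-! ### Basic properties of the operators on Kostant partitions -/

theorem KPmove_left {x : KPf} {r r' : Root} (h : r ≠ r') : KPmove x r r' r = x r - 1 := by
  simp [KPmove, KPadd, KPsub, h]

theorem KPmove_right {x : KPf} {r r' : Root} (h : r ≠ r') : KPmove x r r' r' = x r' + 1 := by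
  simp [KPmove, KPadd, KPsub, h.symm]

theorem KPmove_of_ne {x : KPf} {r r' p : Root} (h : p ≠ r) (h' : p ≠ r') :
    KPmove x r r' p = x p := by
  simp [KPmove, KPadd, KPsub, h, h']

theorem KPmove_KPmove {x : KPf} {r r' : Root} (h : r ≠ r') (h0 : 0 < x r) :
    KPmove (KPmove x r r') r' r = x := by
  funext p
  by_cases h1 : p = r
  · subst h1
    rw [KPmove_right h.symm, KPmove_left h]; omega
  · by_cases h2 : p = r'
    · subst h2
      rw [KPmove_left h.symm, KPmove_right h]; omega
    · rw [KPmove_of_ne h2 h1, KPmove_of_ne h1 h2]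

/-- The blocks whose roots can be exchanged. -/
def Good (n i : ℕ) (k : Blk) : Prop :=
  (∃ h, 1 ≤ h ∧ h < i ∧ k = rowB i h) ∨ (∃ b, i + 1 < b ∧ b ≤ n ∧ k = colB i b)

theorem nodup_blks (n i : ℕ) : (blks n i).Nodup := by
  rw [blks, List.nodup_append]
  refine ⟨?_, ?_, ?_⟩
  · refine List.Nodup.map ?_ List.nodup_range
    intro a b h; simpa [rowB] using h
  · refine List.Nodup.map ?_ (List.nodup_reverse.2 List.nodup_range)
    intro a b h; simpa [colB] using h
  · intro a ha b hb
    obtain ⟨h, -, rfl⟩ := mem_blkW.1 ha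
    obtain ⟨h, -, rfl⟩ := mem_blkS.1 hb
    simp only [rowB, colB, ne_eq, Prod.mk.injEq]; omega

theorem mem_blks {n i : ℕ} {k : Blk} :
    k ∈ blks n i ↔ (∃ h ≤ n, k = rowB i h) ∨ (∃ h ≤ n, k = colB i h) := by
  rw [blks, List.mem_append, mem_blkW, mem_blkS]

theorem Good.ne {n i : ℕ} {k : Blk} (h : Good n i k) : k.1 ≠ k.2 := by
  rcases h with ⟨h, -, -, rfl⟩ | ⟨h, -, -, rfl⟩ <;> simp [rowB, colB]

theorem Good.ne_simple {n i : ℕ} {k : Blk} (h : Good n i k) : k.2 ≠ (i, i + 1) := by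
  rcases h with ⟨h, h1, h2, rfl⟩ | ⟨h, h1, h2, rfl⟩ <;> simp [rowB, colB] <;> omega

theorem Good.isPos_left {n i : ℕ} {k : Blk} (h : Good n i k) (hi2 : i + 1 ≤ n) :
    IsPos n k.1 := by
  rcases h with ⟨h, h1, h2, rfl⟩ | ⟨h, h1, h2, rfl⟩ <;> simp [rowB, colB, IsPos] <;> omega

theorem Good.isPos_right {n i : ℕ} {k : Blk} (h : Good n i k) (hi : 1 ≤ i) (hi2 : i + 1 ≤ n) :
    IsPos n k.2 := by
  rcases h with ⟨h, h1, h2, rfl⟩ | ⟨h, h1, h2, rfl⟩ <;> simp [rowB, colB, IsPos] <;> omega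

theorem Good.other {n i : ℕ} {k a : Blk} (h : Good n i k) (ha : a ∈ blks n i) (hak : a ≠ k) :
    a.1 ≠ k.1 ∧ a.1 ≠ k.2 ∧ a.2 ≠ k.1 ∧ a.2 ≠ k.2 := by
  rw [mem_blks] at ha
  rcases h with ⟨h, h1, h2, rfl⟩ | ⟨h, h1, h2, rfl⟩ <;>
  rcases ha with ⟨b, h3, rfl⟩ | ⟨b, h3, rfl⟩ <;>
  simp only [rowB, colB, ne_eq, Prod.mk.injEq, true_and, and_true] at hak ⊢ <;> omega

theorem good_of_fpos {n i : ℕ} {x : KPf} (hx : IsKP n x) {k : Blk}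
    (h : fpos (bp x) (bm x) (blks n i) = some k) : Good n i k ∧ 0 < x k.1 := by
  obtain ⟨h1, h2⟩ := mem_of_fpos _ _ h
  refine ⟨?_, h2⟩
  have h3 := hx k.1 (by have : bp x k = x k.1 := rfl; omega)
  rcases mem_blks.1 h1 with ⟨b, hb, rfl⟩ | ⟨b, hb, rfl⟩
  · simp only [IsPos, rowB] at h3
    exact Or.inl ⟨b, by omega, by omega, rfl⟩
  · simp only [IsPos, colB] at h3
    exact Or.inr ⟨b, by omega, by omega, rfl⟩

theorem good_of_epos {n i : ℕ} {x : KPf} (hx : IsKP n x) {k : Blk}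
    (h : epos (bp x) (bm x) (blks n i) = some k) (hk : k.2 ≠ (i, i + 1)) :
    Good n i k ∧ 0 < x k.2 := by
  obtain ⟨h1, h2⟩ := mem_of_epos _ _ h
  refine ⟨?_, h2⟩
  have h3 := hx k.2 (by have : bm x k = x k.2 := rfl; omega)
  rcases mem_blks.1 h1 with ⟨b, hb, rfl⟩ | ⟨b, hb, rfl⟩
  · simp only [IsPos, rowB, ne_eq, Prod.mk.injEq, and_true] at h3 hk
    exact Or.inl ⟨b, by omega, by omega, rfl⟩
  · simp only [IsPos, colB, ne_eq, Prod.mk.injEq, true_and] at h3 hk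
    exact Or.inr ⟨b, by omega, by omega, rfl⟩

theorem isKP_move {n : ℕ} {x : KPf} (hx : IsKP n x) {r r' : Root} (hr : IsPos n r') :
    IsKP n (KPmove x r r') := by
  intro p hp
  by_cases h1 : p = r'
  · rw [h1]; exact hr
  · refine hx p fun h0 => hp ?_
    simp only [KPmove, KPadd, KPsub, h1, if_false, h0]
    split_ifs <;> rfl

theorem Good.bp_bm_of_ne {n i : ℕ} {x : KPf} {k a : Blk} (h : Good n i k) (ha : a ∈ blks n i)
    (hak : a ≠ k) : bp (KPmove x k.1 k.2) a = bp x a ∧ bm (KPmove x k.1 k.2) a = bm x a := by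
  obtain ⟨h1, h2, h3, h4⟩ := h.other ha hak
  exact ⟨KPmove_of_ne h1 h2, KPmove_of_ne h3 h4⟩

theorem Good.bp_bm_of_ne' {n i : ℕ} {x : KPf} {k a : Blk} (h : Good n i k) (ha : a ∈ blks n i)
    (hak : a ≠ k) : bp (KPmove x k.2 k.1) a = bp x a ∧ bm (KPmove x k.2 k.1) a = bm x a := by
  obtain ⟨h1, h2, h3, h4⟩ := h.other ha hak
  exact ⟨KPmove_of_ne h2 h1, KPmove_of_ne h4 h3⟩

/-- Description of a successful application of `fop`. -/
theorem fop_eq_some {n i : ℕ} {x y : KPf} (hx : IsKP n x) (h : fop n i x = some y) :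
    ∃ k, fpos (bp x) (bm x) (blks n i) = some k ∧ Good n i k ∧ 0 < x k.1 ∧
      y = KPmove x k.1 k.2 := by
  rw [fop_eq, Option.map_eq_some_iff] at h
  obtain ⟨k, hk, rfl⟩ := h
  obtain ⟨hg, hp⟩ := good_of_fpos hx hk
  exact ⟨k, hk, hg, hp, rfl⟩

theorem isKP_of_fop {n i : ℕ} (hi : 1 ≤ i) (hi2 : i + 1 ≤ n) {x y : KPf} (hx : IsKP n x)
    (h : fop n i x = some y) : IsKP n y := by
  obtain ⟨k, -, hg, -, rfl⟩ := fop_eq_some hx h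
  exact isKP_move hx (hg.isPos_right hi hi2)

theorem stats_fop {n i : ℕ} {x y : KPf} (hx : IsKP n x) (h : fop n i x = some y) :
    eop n i y = some x ∧
    lpl (bp y) (bm y) (blks n i) + 1 = lpl (bp x) (bm x) (blks n i) ∧
    lmi (bp y) (bm y) (blks n i) = lmi (bp x) (bm x) (blks n i) + 1 := by
  obtain ⟨k, hk, hg, hp, rfl⟩ := fop_eq_some hx h
  obtain ⟨h1, h2, h3⟩ := epos_of_fpos (φ' := bp (KPmove x k.1 k.2)) (ε' := bm (KPmove x k.1 k.2))
    (nodup_blks n i) hk (by simp only [bp, KPmove_left hg.ne]; omega) (KPmove_right hg.ne)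
    fun a ha hak => hg.bp_bm_of_ne ha hak
  refine ⟨?_, h2, h3⟩
  rw [eop_eq, h1, Option.bind_some, if_neg hg.ne_simple, KPmove_KPmove hg.ne hp]

/-- Description of a successful application of `eop`. -/
theorem eop_eq_some {n i : ℕ} {x y : KPf} (hx : IsKP n x) (h : eop n i x = some y) :
    ∃ k, epos (bp x) (bm x) (blks n i) = some k ∧ Good n i k ∧ 0 < x k.2 ∧
      y = KPmove x k.2 k.1 := by
  rw [eop_eq, Option.bind_eq_some_iff] at h
  obtain ⟨k, hk, h⟩ := h
  split_ifs at h with h1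
  obtain ⟨hg, hp⟩ := good_of_epos hx hk h1
  exact ⟨k, hk, hg, hp, (Option.some.inj h).symm⟩

theorem isKP_of_eop {n i : ℕ} (hi2 : i + 1 ≤ n) {x y : KPf} (hx : IsKP n x)
    (h : eop n i x = some y) : IsKP n y := by
  obtain ⟨k, -, hg, -, rfl⟩ := eop_eq_some hx h
  exact isKP_move hx (hg.isPos_left hi2)

theorem fop_of_eop {n i : ℕ} {x y : KPf} (hx : IsKP n x) (h : eop n i x = some y) :
    fop n i y = some x := by
  obtain ⟨k, hk, hg, hp, rfl⟩ := eop_eq_some hx h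
  obtain ⟨h1, -, -⟩ := fpos_of_epos (φ' := bp (KPmove x k.2 k.1)) (ε' := bm (KPmove x k.2 k.1))
    (nodup_blks n i) hk (KPmove_right hg.ne.symm)
    (by simp only [bm, KPmove_left hg.ne.symm]; omega)
    fun a ha hak => hg.bp_bm_of_ne' ha hak
  rw [fop_eq, h1, Option.map_some, KPmove_KPmove hg.ne.symm hp]

theorem itr_succ_right {A : Type*} (g : A → Option A) (k : ℕ) (x : A) :
    itr g (k + 1) x = (itr g k x).bind g := by
  rw [itr_add]
  congr 1; funext y; simp [itr]

theorem itr_fop_isKP {n i : ℕ} (hi : 1 ≤ i) (hi2 : i + 1 ≤ n) {k : ℕ} {x y : KPf}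
    (hx : IsKP n x) (h : itr (fop n i) k x = some y) : IsKP n y := by
  induction k generalizing x with
  | zero => cases h; exact hx
  | succ k ih =>
    rw [itr, Option.bind_eq_some_iff] at h
    obtain ⟨z, hz, h⟩ := h
    exact ih (isKP_of_fop hi hi2 hx hz) h

theorem itr_eop_of_fop {n i : ℕ} (hi : 1 ≤ i) (hi2 : i + 1 ≤ n) {k : ℕ} {x y : KPf}
    (hx : IsKP n x) (h : itr (fop n i) k x = some y) : itr (eop n i) k y = some x := by
  induction k generalizing x with
  | zero => cases h; rfl
  | succ k ih =>
    rw [itr, Option.bind_eq_some_iff] at h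
    obtain ⟨z, hz, h⟩ := h
    rw [itr_succ_right, ih (isKP_of_fop hi hi2 hx hz) h, Option.bind_some, (stats_fop hx hz).1]

theorem itr_fop_of_eop {n i : ℕ} (hi2 : i + 1 ≤ n) {k : ℕ} {x y : KPf}
    (hx : IsKP n x) (h : itr (eop n i) k x = some y) : itr (fop n i) k y = some x ∧ IsKP n y := by
  induction k generalizing x with
  | zero => cases h; exact ⟨rfl, hx⟩
  | succ k ih =>
    rw [itr, Option.bind_eq_some_iff] at h
    obtain ⟨z, hz, h⟩ := h
    obtain ⟨h1, h2⟩ := ih (isKP_of_eop hi2 hx hz) h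
    exact ⟨by rw [itr_succ_right, h1, Option.bind_some, fop_of_eop hx hz], h2⟩

theorem itr_fop_exists {n i : ℕ} (hi : 1 ≤ i) (hi2 : i + 1 ≤ n) {k : ℕ} {x : KPf}
    (hx : IsKP n x) (h : k ≤ lpl (bp x) (bm x) (blks n i)) :
    ∃ y, itr (fop n i) k x = some y := by
  induction k generalizing x with
  | zero => exact ⟨x, rfl⟩
  | succ k ih =>
    cases hf : fop n i x with
    | none =>
      rw [fop_eq, Option.map_eq_none_iff, fpos_eq_none_iff] at hf; omega
    | some z =>
      have := (stats_fop hx hf).2.1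
      obtain ⟨y, hy⟩ := ih (isKP_of_fop hi hi2 hx hf) (by omega)
      exact ⟨y, by rw [itr, hf, Option.bind_some, hy]⟩

/-! ### Evaluation -/

theorem kpEval_move {n : ℕ} {x : KPf} {r r' : Root} (hne : r ≠ r') (h0 : 0 < x r)
    (hr : IsPos n r) (hr' : IsPos n r') (c : ℕ) :
    kpEval n (KPmove x r r') c = kpEval n x c
      - ((if r.1 = c then 1 else 0) - (if r.2 = c then 1 else 0))
      + ((if r'.1 = c then 1 else 0) - (if r'.2 = c then 1 else 0)) := by
  have key : ∀ p : Root, ((KPmove x r r' p : ℕ) : ℤ) =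
      x p - (if p = r then 1 else 0) + (if p = r' then 1 else 0) := by
    intro p
    by_cases h1 : p = r
    · subst h1
      rw [KPmove_left hne, if_pos rfl, if_neg hne]; omega
    · by_cases h2 : p = r'
      · subst h2
        rw [KPmove_right hne, if_pos rfl, if_neg h1]; push_cast; ring
      · rw [KPmove_of_ne h1 h2, if_neg h1, if_neg h2]; ring
  have mem : ∀ p : Root, IsPos n p → p ∈ kbox n := by
    intro p hp
    simp only [IsPos] at hp
    simp only [kbox, Finset.mem_product, Finset.mem_range]; omega
  simp only [kpEval, key, add_mul, sub_mul, Finset.sum_add_distrib, Finset.sum_sub_distrib,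
    ite_mul, one_mul, zero_mul, Finset.sum_ite_eq', mem r hr, mem r' hr', if_true]

theorem kpEval_fop {n i : ℕ} (hi : 1 ≤ i) (hi2 : i + 1 ≤ n) {x y : KPf} (hx : IsKP n x)
    (h : fop n i x = some y) (c : ℕ) : kpEval n y c = kpEval n x c + srVec i c := by
  obtain ⟨k, -, hg, hp, rfl⟩ := fop_eq_some hx h
  rw [kpEval_move hg.ne hp (hg.isPos_left hi2) (hg.isPos_right hi hi2), srVec]
  rcases hg with ⟨b, -, -, rfl⟩ | ⟨b, -, -, rfl⟩ <;> simp only [rowB, colB] <;>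
    split_ifs <;> omega

theorem kpEval_itr_fop {n i : ℕ} (hi : 1 ≤ i) (hi2 : i + 1 ≤ n) {k : ℕ} {x y : KPf}
    (hx : IsKP n x) (h : itr (fop n i) k x = some y) (c : ℕ) :
    kpEval n y c = kpEval n x c + k * srVec i c := by
  induction k generalizing x with
  | zero => cases h; simp
  | succ k ih =>
    rw [itr, Option.bind_eq_some_iff] at h
    obtain ⟨z, hz, h⟩ := h
    rw [ih (isKP_of_fop hi hi2 hx hz) h, kpEval_fop hi hi2 hx hz]; push_cast; ring

theorem kpEval_eq {n c : ℕ} (hc : c ≤ n) (x : KPf) :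
    kpEval n x c = ∑ b ∈ Finset.range (n + 1), (x (c, b) : ℤ)
      - ∑ h ∈ Finset.range (n + 1), (x (h, c) : ℤ) := by
  simp only [kpEval, kbox, mul_sub, Finset.sum_sub_distrib, mul_ite, mul_one, mul_zero]
  congr 1
  · rw [Finset.sum_product_right]
    refine Finset.sum_congr rfl fun b _ => ?_
    simp; omega
  · rw [Finset.sum_product]
    refine Finset.sum_congr rfl fun b _ => ?_
    simp; omega

theorem stats_eval {n i : ℕ} (hi2 : i + 1 ≤ n) (x : KPf) :
    (lpl (bp x) (bm x) (blks n i) : ℤ) - lmi (bp x) (bm x) (blks n i) =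
      kpEval n x (i + 1) - kpEval n x i := by
  rw [lpl_sub_lmi, kpEval_eq hi2, kpEval_eq (by omega : i ≤ n), blks, List.map_append,
    List.sum_append, blkW, blkS, List.map_map, List.map_map, List.map_reverse, List.sum_reverse]
  have e : ∀ (f : ℕ → ℤ), ((List.range (n + 1)).map f).sum = ∑ h ∈ Finset.range (n + 1), f h := by
    intro f; rfl
  rw [e, e]
  simp only [Function.comp_def, rowB, colB, bp, bm, Finset.sum_sub_distrib]
  ring


/-! ### Interaction of `eop` with a neighbouring `fop` -/

/-- The blocks of `W_i` below the simple root. -/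
def rowsB (i : ℕ) : List Blk := (List.range i).map (rowB i)

/-- The blocks of `W_i*` above the simple root. -/
def colsA (n i : ℕ) : List Blk := (List.range' (i + 2) (n - i - 1)).reverse.map (colB i)

theorem blks_split {n i : ℕ} (hi2 : i + 1 ≤ n) : ∃ Z Z' : List Blk,
    blks n i = rowsB i ++ (rowB i i :: (Z ++ (colsA n i ++ (colB i (i + 1) :: Z')))) ∧
    (∀ a ∈ Z, ∃ h, i < h ∧ a = rowB i h) ∧ (∀ a ∈ Z', ∃ b ≤ i, a = colB i b) := by
  refine ⟨(List.range' (i + 1) (n - i)).map (rowB i), (List.range (i + 1)).reverse.map (colB i),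
    ?_, ?_, ?_⟩
  · have e1 : List.range (n + 1) = List.range i ++ (i :: List.range' (i + 1) (n - i)) := by
      have h1 : i :: List.range' (i + 1) (n - i) = List.range' (0 + i) (n - i + 1) := by
        rw [List.range'_succ, Nat.zero_add]
      rw [h1, List.range_eq_range', List.range_eq_range', List.range'_append_1]
      congr 1; omega
    have e2 : List.range (n + 1) =
        List.range (i + 1) ++ ((i + 1) :: List.range' (i + 2) (n - i - 1)) := by
      have h1 : (i + 1) :: List.range' (i + 2) (n - i - 1) =
          List.range' (0 + (i + 1)) (n - i - 1 + 1) := by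
        rw [List.range'_succ, Nat.zero_add]
      rw [h1, List.range_eq_range', List.range_eq_range', List.range'_append_1]
      congr 1; omega
    have hW : blkW n i = rowsB i ++ (rowB i i :: (List.range' (i + 1) (n - i)).map (rowB i)) := by
      rw [blkW, e1]; simp [rowsB]
    have hS : blkS n i =
        colsA n i ++ (colB i (i + 1) :: (List.range (i + 1)).reverse.map (colB i)) := by
      rw [blkS, e2]; simp [colsA]
    rw [blks, hW, hS]
    simp
  · intro a ha
    simp only [List.mem_map, List.mem_range'_1] at ha
    obtain ⟨b, hb, rfl⟩ := ha
    exact ⟨b, by omega, rfl⟩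
  · intro a ha
    simp only [List.mem_map, List.mem_reverse, List.mem_range] at ha
    obtain ⟨b, hb, rfl⟩ := ha
    exact ⟨b, by omega, rfl⟩

theorem mem_rowsB {i : ℕ} {a : Blk} : a ∈ rowsB i ↔ ∃ h < i, a = rowB i h := by
  simp [rowsB, eq_comm]

theorem mem_colsA {n i : ℕ} {a : Blk} : a ∈ colsA n i ↔ ∃ b, i + 2 ≤ b ∧ b ≤ n ∧ a = colB i b := by
  simp only [colsA, List.mem_map, List.mem_reverse, List.mem_range'_1]
  constructor
  · rintro ⟨b, h, rfl⟩; exact ⟨b, by omega, by omega, rfl⟩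
  · rintro ⟨b, h, h', rfl⟩; exact ⟨b, by omega, rfl⟩

theorem rowsB_sub {n i : ℕ} (hi2 : i + 1 ≤ n) {a : Blk} (h : a ∈ rowsB i) : a ∈ blks n i := by
  obtain ⟨Z, Z', e, -, -⟩ := blks_split hi2
  rw [e]; simp [h]

theorem colsA_sub {n i : ℕ} (hi2 : i + 1 ≤ n) {a : Blk} (h : a ∈ colsA n i) : a ∈ blks n i := by
  obtain ⟨Z, Z', e, -, -⟩ := blks_split hi2
  rw [e]; simp [h]

theorem nodup_rowsB (i : ℕ) : (rowsB i).Nodup :=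
  List.nodup_range.map fun a b h => by simpa [rowB] using h

theorem nodup_colsA (n i : ℕ) : (colsA n i).Nodup :=
  (List.nodup_reverse.2 (List.nodup_range' (step := 1))).map fun a b h => by simpa [colB] using h

theorem IsKP.eq_zero {n : ℕ} {x : KPf} (hx : IsKP n x) {a b : ℕ} (h : b ≤ a) : x (a, b) = 0 := by
  by_contra h0
  have := hx _ h0
  simp only [IsPos] at this; omega

/-- The result of `eop` on a Kostant partition, in terms of the two halves of the word. -/
theorem epos_blks {n i : ℕ} (hi2 : i + 1 ≤ n) {x : KPf} (hx : IsKP n x) (m p q r : ℕ)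
    (hm : x (i, i + 1) = m)
    (hp : lpl (bp x) (bm x) (colsA n i) = p) (hq : lmi (bp x) (bm x) (colsA n i) = q)
    (hr : lpl (bp x) (bm x) (rowsB i) = r) :
    (m ≤ p → r < m + q → 0 < q →
      epos (bp x) (bm x) (blks n i) = epos (bp x) (bm x) (colsA n i)) ∧
    (m + q + (m - p) ≤ r → epos (bp x) (bm x) (blks n i) = epos (bp x) (bm x) (rowsB i)) ∧
    (r < m + q + (m - p) → (p < m ∨ q = 0) → eop n i x = none) := by
  obtain ⟨Z, Z', e, hZ, hZ'⟩ := blks_split hi2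
  have z1 : ∀ a ∈ Z, bp x a = 0 ∧ bm x a = 0 := by
    intro a ha
    obtain ⟨h, h1, rfl⟩ := hZ a ha
    exact ⟨hx.eq_zero (by omega), hx.eq_zero (by omega)⟩
  have z2 : ∀ a ∈ Z', bp x a = 0 ∧ bm x a = 0 := by
    intro a ha
    obtain ⟨h, h1, rfl⟩ := hZ' a ha
    exact ⟨hx.eq_zero (by omega), hx.eq_zero (by omega)⟩
  have c1 : bp x (rowB i i) = 0 := hx.eq_zero le_rfl
  have c2 : bm x (rowB i i) = m := hm
  have c3 : bp x (colB i (i + 1)) = 0 := hx.eq_zero le_rfl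
  have c4 : bm x (colB i (i + 1)) = m := hm
  have l1 : lmi (bp x) (bm x) (colB i (i + 1) :: Z') = m := by
    rw [lmi, lmi_eq_zero z2, c4]; omega
  have l2 : lmi (bp x) (bm x) (colsA n i ++ (colB i (i + 1) :: Z')) = q + (m - p) := by
    rw [lmi_append, l1, hp, hq]
  have l3 : lmi (bp x) (bm x) (Z ++ (colsA n i ++ (colB i (i + 1) :: Z'))) = q + (m - p) := by
    rw [lmi_append, lmi_eq_zero z1, lpl_eq_zero z1, l2]; omega
  have l4 : lmi (bp x) (bm x) (rowB i i :: (Z ++ (colsA n i ++ (colB i (i + 1) :: Z')))) =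
      m + q + (m - p) := by
    rw [lmi, l3, c1, c2]; omega
  have e1 : 0 < q + (m - p) →
      epos (bp x) (bm x) (rowB i i :: (Z ++ (colsA n i ++ (colB i (i + 1) :: Z')))) =
      epos (bp x) (bm x) (colsA n i ++ (colB i (i + 1) :: Z')) := by
    intro h
    rw [epos, l3, c1, if_pos h, epos_append, lpl_eq_zero z1, l2, if_pos h]
  refine ⟨?_, ?_, ?_⟩
  · intro h1 h2 h3
    rw [e, epos_append, l4, hr, if_pos (by omega), e1 (by omega), epos_append, l1, hp,
      if_neg (by omega)]
  · intro h1
    rw [e, epos_append, l4, hr, if_neg (by omega)]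
  · intro h1 h2
    rw [eop_eq, e, epos_append, l4, hr, if_pos h1]
    by_cases h3 : p < m
    · rw [e1 (by omega), epos_append, l1, hp, if_pos h3, epos, c3, lmi_eq_zero z2,
        if_neg (by omega), c4, if_pos (by omega), Option.bind_some]
      simp [colB]
    · have h4 : q = 0 := by omega
      rw [epos, l3, c1, if_neg (by omega), c2]
      split_ifs
      · rw [Option.bind_some]; simp [rowB]
      · rfl

/-- Numerical criterion for `e_i^t ≠ 0`. -/
def ET (m p q r s t : ℕ) : Prop :=
  t = 0 ∨ (p < m ∧ 2 * m + q ≤ r + p ∧ t ≤ s) ∨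
    (m ≤ p ∧ ((r < m ∧ t ≤ q) ∨ (m ≤ r ∧ t ≤ s + (q + m - r))))

theorem itr_eop_ne_none_iff {n i : ℕ} (hi2 : i + 1 ≤ n) (t : ℕ) {x : KPf} (hx : IsKP n x) :
    itr (eop n i) t x ≠ none ↔
      ET (x (i, i + 1)) (lpl (bp x) (bm x) (colsA n i)) (lmi (bp x) (bm x) (colsA n i))
        (lpl (bp x) (bm x) (rowsB i)) (lmi (bp x) (bm x) (rowsB i)) t := by
  induction t generalizing x with
  | zero => simp [itr, ET]
  | succ t ih =>
    obtain ⟨m, hm⟩ : ∃ m, x (i, i + 1) = m := ⟨_, rfl⟩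
    obtain ⟨p, hp⟩ : ∃ m, lpl (bp x) (bm x) (colsA n i) = m := ⟨_, rfl⟩
    obtain ⟨q, hq⟩ : ∃ m, lmi (bp x) (bm x) (colsA n i) = m := ⟨_, rfl⟩
    obtain ⟨r, hr⟩ : ∃ m, lpl (bp x) (bm x) (rowsB i) = m := ⟨_, rfl⟩
    obtain ⟨s, hs⟩ : ∃ m, lmi (bp x) (bm x) (rowsB i) = m := ⟨_, rfl⟩
    obtain ⟨h1, h2, h3⟩ := epos_blks hi2 hx m p q r hm hp hq hr
    rw [hm, hp, hq, hr, hs, itr]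
    have hmove : ∀ k, Good n i k → KPmove x k.2 k.1 (i, i + 1) = m := by
      intro k hg
      rw [KPmove_of_ne, hm]
      · exact hg.ne_simple.symm
      · rcases hg with ⟨h, h1, h2, rfl⟩ | ⟨b, h1, h2, rfl⟩ <;>
          simp only [rowB, colB, ne_eq, Prod.mk.injEq] <;> omega
    by_cases hA : m ≤ p ∧ r < m + q ∧ 0 < q
    · obtain ⟨k, hk⟩ : ∃ k, epos (bp x) (bm x) (colsA n i) = some k := by
        cases hk : epos (bp x) (bm x) (colsA n i) with
        | none => rw [epos_eq_none_iff] at hk; omega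
        | some k => exact ⟨k, rfl⟩
      have hkA := (mem_of_epos _ _ hk).1
      obtain ⟨hg, hpos⟩ : Good n i k ∧ 0 < x k.2 := by
        refine good_of_epos hx ((h1 hA.1 hA.2.1 hA.2.2).trans hk) ?_
        obtain ⟨b, hb, -, rfl⟩ := mem_colsA.1 hkA
        simp only [colB, ne_eq, Prod.mk.injEq, true_and]; omega
      have he : eop n i x = some (KPmove x k.2 k.1) := by
        rw [eop_eq, h1 hA.1 hA.2.1 hA.2.2, hk, Option.bind_some, if_neg hg.ne_simple]
      obtain ⟨-, i1, i2⟩ := fpos_of_epos (φ' := bp (KPmove x k.2 k.1))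
        (ε' := bm (KPmove x k.2 k.1)) (nodup_colsA n i) hk (KPmove_right hg.ne.symm)
        (by simp only [bm, KPmove_left hg.ne.symm]; omega)
        fun a ha hak => hg.bp_bm_of_ne' (colsA_sub hi2 ha) hak
      have hB : ∀ a ∈ rowsB i, bp (KPmove x k.2 k.1) a = bp x a ∧
          bm (KPmove x k.2 k.1) a = bm x a := by
        refine fun a ha => hg.bp_bm_of_ne' (rowsB_sub hi2 ha) ?_
        rintro rfl
        obtain ⟨b, hb, -, rfl⟩ := mem_colsA.1 hkA
        obtain ⟨b', hb', h⟩ := mem_rowsB.1 ha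
        simp only [colB, rowB, Prod.mk.injEq] at h; omega
      rw [he, Option.bind_some, ih (isKP_of_eop hi2 hx he), lmi_congr hB, lpl_congr hB, hmove k hg]
      simp only [ET]
      omega
    · by_cases hB : m + q + (m - p) ≤ r ∧ 0 < s
      · obtain ⟨k, hk⟩ : ∃ k, epos (bp x) (bm x) (rowsB i) = some k := by
          cases hk : epos (bp x) (bm x) (rowsB i) with
          | none => rw [epos_eq_none_iff] at hk; omega
          | some k => exact ⟨k, rfl⟩
        have hkB := (mem_of_epos _ _ hk).1
        obtain ⟨hg, hpos⟩ : Good n i k ∧ 0 < x k.2 := by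
          refine good_of_epos hx ((h2 hB.1).trans hk) ?_
          obtain ⟨b, hb, rfl⟩ := mem_rowsB.1 hkB
          simp only [rowB, ne_eq, Prod.mk.injEq, and_true]; omega
        have he : eop n i x = some (KPmove x k.2 k.1) := by
          rw [eop_eq, h2 hB.1, hk, Option.bind_some, if_neg hg.ne_simple]
        obtain ⟨-, i1, i2⟩ := fpos_of_epos (φ' := bp (KPmove x k.2 k.1))
          (ε' := bm (KPmove x k.2 k.1)) (nodup_rowsB i) hk (KPmove_right hg.ne.symm)
          (by simp only [bm, KPmove_left hg.ne.symm]; omega)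
          fun a ha hak => hg.bp_bm_of_ne' (rowsB_sub hi2 ha) hak
        have hA : ∀ a ∈ colsA n i, bp (KPmove x k.2 k.1) a = bp x a ∧
            bm (KPmove x k.2 k.1) a = bm x a := by
          refine fun a ha => hg.bp_bm_of_ne' (colsA_sub hi2 ha) ?_
          rintro rfl
          obtain ⟨b, hb, -, rfl⟩ := mem_colsA.1 ha
          obtain ⟨b', hb', h⟩ := mem_rowsB.1 hkB
          simp only [colB, rowB, Prod.mk.injEq] at h; omega
        rw [he, Option.bind_some, ih (isKP_of_eop hi2 hx he), lmi_congr hA, lpl_congr hA,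
          hmove k hg]
        simp only [ET]
        omega
      · have he : eop n i x = none := by
          by_cases hs0 : m + q + (m - p) ≤ r
          · rw [eop_eq, h2 hs0, (epos_eq_none_iff _ _ _).2 (by omega)]; rfl
          · exact h3 (by omega) (by omega)
        rw [he]
        simp only [ET, Option.bind_none, ne_eq, not_true_eq_false, false_iff]
        omega

theorem itr_eop_of_fop_succ {n i : ℕ} (hi : 1 ≤ i) (hi2 : i + 2 ≤ n) {t : ℕ} {x y : KPf}
    (hx : IsKP n x) (h : fop n (i + 1) x = some y) (ht : itr (eop n i) (t + 1) x ≠ none) :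
    itr (eop n i) t y ≠ none := by
  have hy := isKP_of_fop (by omega) (by omega) hx h
  rw [itr_eop_ne_none_iff (by omega) _ hx] at ht
  rw [itr_eop_ne_none_iff (by omega) _ hy]
  obtain ⟨k, -, hg, hpos, rfl⟩ := fop_eq_some hx h
  clear h hy
  rcases hg with ⟨h, h1, h2, rfl⟩ | ⟨b, h1, h2, rfl⟩
  · by_cases hhi : h < i
    · have e1 : KPmove x (rowB (i + 1) h).1 (rowB (i + 1) h).2 (i, i + 1) = x (i, i + 1) := by
        apply KPmove_of_ne <;> simp only [rowB, ne_eq, Prod.mk.injEq, and_true] <;> omega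
      have hA : ∀ a ∈ colsA n i, bp (KPmove x (rowB (i + 1) h).1 (rowB (i + 1) h).2) a = bp x a ∧
            bm (KPmove x (rowB (i + 1) h).1 (rowB (i + 1) h).2) a = bm x a := by
        intro a ha
        obtain ⟨b, hb, -, rfl⟩ := mem_colsA.1 ha
        constructor <;> apply KPmove_of_ne <;>
          simp only [rowB, colB, ne_eq, Prod.mk.injEq] <;> omega
      have := stats_bump (φ := bp x) (ε := bm x)
        (φ' := bp (KPmove x (rowB (i + 1) h).1 (rowB (i + 1) h).2))
        (ε' := bm (KPmove x (rowB (i + 1) h).1 (rowB (i + 1) h).2)) (k := rowB i h)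
        (nodup_rowsB i) (mem_rowsB.2 ⟨h, hhi, rfl⟩)
        (Or.inr ⟨by apply KPmove_of_ne <;> simp only [rowB, ne_eq, Prod.mk.injEq, true_and] <;> omega, by
          simp only [bm, rowB] at hpos ⊢
          rw [KPmove_left (by simp)]; omega⟩) (by
          intro a ha hak
          obtain ⟨h', hb, rfl⟩ := mem_rowsB.1 ha
          simp only [rowB, ne_eq, Prod.mk.injEq, and_true] at hak
          constructor <;> apply KPmove_of_ne <;>
            simp only [rowB, ne_eq, Prod.mk.injEq, and_true] <;> omega)
      rw [e1, lmi_congr hA, lpl_congr hA]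
      simp only [ET] at ht ⊢
      omega
    · have : h = i := by omega
      subst this
      have e1 : KPmove x (rowB (h + 1) h).1 (rowB (h + 1) h).2 (h, h + 1) + 1 = x (h, h + 1) := by
        simp only [rowB] at hpos ⊢
        rw [KPmove_left (by simp)]; omega
      have hB : ∀ a ∈ rowsB h, bp (KPmove x (rowB (h + 1) h).1 (rowB (h + 1) h).2) a = bp x a ∧
            bm (KPmove x (rowB (h + 1) h).1 (rowB (h + 1) h).2) a = bm x a := by
        intro a ha
        obtain ⟨b, hb, rfl⟩ := mem_rowsB.1 ha
        constructor <;> apply KPmove_of_ne <;>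
          simp only [rowB, ne_eq, Prod.mk.injEq, and_true] <;> omega
      have := stats_bump (φ' := bp x) (ε' := bm x)
        (φ := bp (KPmove x (rowB (h + 1) h).1 (rowB (h + 1) h).2))
        (ε := bm (KPmove x (rowB (h + 1) h).1 (rowB (h + 1) h).2)) (k := colB h (h + 2))
        (nodup_colsA n h) (mem_colsA.2 ⟨h + 2, by omega, by omega, rfl⟩)
        (Or.inr ⟨by
          symm; apply KPmove_of_ne <;> simp only [rowB, colB, ne_eq, Prod.mk.injEq, and_true] <;> omega, by
          simp only [bm, rowB, colB]
          rw [KPmove_right (by simp)]⟩) (by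
          intro a ha hak
          obtain ⟨h', hb, -, rfl⟩ := mem_colsA.1 ha
          simp only [colB, ne_eq, Prod.mk.injEq, true_and] at hak
          constructor <;> symm <;> apply KPmove_of_ne <;>
            simp only [colB, rowB, ne_eq, Prod.mk.injEq, true_and] <;> omega)
      rw [lmi_congr hB, lpl_congr hB]
      simp only [ET] at ht ⊢
      omega
  · have e1 : KPmove x (colB (i + 1) b).1 (colB (i + 1) b).2 (i, i + 1) = x (i, i + 1) := by
      apply KPmove_of_ne <;> simp only [colB, ne_eq, Prod.mk.injEq] <;> omega
    have hB : ∀ a ∈ rowsB i, bp (KPmove x (colB (i + 1) b).1 (colB (i + 1) b).2) a = bp x a ∧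
          bm (KPmove x (colB (i + 1) b).1 (colB (i + 1) b).2) a = bm x a := by
      intro a ha
      obtain ⟨b, hb, rfl⟩ := mem_rowsB.1 ha
      constructor <;> apply KPmove_of_ne <;>
        simp only [rowB, colB, ne_eq, Prod.mk.injEq] <;> omega
    have := stats_bump (φ := bp x) (ε := bm x)
      (φ' := bp (KPmove x (colB (i + 1) b).1 (colB (i + 1) b).2))
      (ε' := bm (KPmove x (colB (i + 1) b).1 (colB (i + 1) b).2)) (k := colB i b)
      (nodup_colsA n i) (mem_colsA.2 ⟨b, by omega, by omega, rfl⟩)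
      (Or.inl ⟨by
        simp only [bp, colB]
        rw [KPmove_right (by simp)], by
        apply KPmove_of_ne <;> simp only [colB, ne_eq, Prod.mk.injEq, and_true] <;> omega⟩) (by
        intro a ha hak
        obtain ⟨h', hb, -, rfl⟩ := mem_colsA.1 ha
        simp only [colB, ne_eq, Prod.mk.injEq, true_and] at hak
        constructor <;> apply KPmove_of_ne <;>
          simp only [colB, ne_eq, Prod.mk.injEq, true_and] <;> omega)
    rw [e1, lmi_congr hB, lpl_congr hB]
    simp only [ET] at ht ⊢
    omega

theorem itr_eop_of_fop_pred {n j : ℕ} (hj : 1 ≤ j) (hj2 : j + 2 ≤ n) {t : ℕ} {x y : KPf}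
    (hx : IsKP n x) (h : fop n j x = some y) (ht : itr (eop n (j + 1)) (t + 1) x ≠ none) :
    itr (eop n (j + 1)) t y ≠ none := by
  have hy := isKP_of_fop hj (by omega) hx h
  rw [itr_eop_ne_none_iff (by omega) _ hx] at ht
  rw [itr_eop_ne_none_iff (by omega) _ hy]
  obtain ⟨k, -, hg, hpos, rfl⟩ := fop_eq_some hx h
  clear h hy
  rcases hg with ⟨h, h1, h2, rfl⟩ | ⟨b, h1, h2, rfl⟩
  · have e1 : KPmove x (rowB j h).1 (rowB j h).2 (j + 1, j + 1 + 1) = x (j + 1, j + 1 + 1) := by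
      apply KPmove_of_ne <;> simp only [rowB, ne_eq, Prod.mk.injEq] <;> omega
    have hA : ∀ a ∈ colsA n (j + 1), bp (KPmove x (rowB j h).1 (rowB j h).2) a = bp x a ∧
          bm (KPmove x (rowB j h).1 (rowB j h).2) a = bm x a := by
      intro a ha
      obtain ⟨b, hb, -, rfl⟩ := mem_colsA.1 ha
      constructor <;> apply KPmove_of_ne <;>
        simp only [rowB, colB, ne_eq, Prod.mk.injEq] <;> omega
    have := stats_bump (φ := bp x) (ε := bm x)
      (φ' := bp (KPmove x (rowB j h).1 (rowB j h).2))
      (ε' := bm (KPmove x (rowB j h).1 (rowB j h).2)) (k := rowB (j + 1) h)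
      (nodup_rowsB (j + 1)) (mem_rowsB.2 ⟨h, by omega, rfl⟩)
      (Or.inl ⟨by
        simp only [bp, rowB]
        rw [KPmove_right (by simp)], by
        apply KPmove_of_ne <;> simp only [rowB, ne_eq, Prod.mk.injEq, true_and] <;> omega⟩) (by
        intro a ha hak
        obtain ⟨h', hb, rfl⟩ := mem_rowsB.1 ha
        simp only [rowB, ne_eq, Prod.mk.injEq, and_true] at hak
        constructor <;> apply KPmove_of_ne <;>
          simp only [rowB, ne_eq, Prod.mk.injEq, and_true] <;> omega)
    rw [e1, lmi_congr hA, lpl_congr hA]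
    simp only [ET] at ht ⊢
    omega
  · by_cases hb1 : b = j + 2
    · subst hb1
      have e1 : KPmove x (colB j (j + 2)).1 (colB j (j + 2)).2 (j + 1, j + 1 + 1) + 1 =
          x (j + 1, j + 1 + 1) := by
        simp only [colB] at hpos ⊢
        have e0 : x (j + 1, j + 1 + 1) = x (j + 1, j + 2) := rfl
        rw [KPmove_left (by simp)]; omega
      have hA : ∀ a ∈ colsA n (j + 1), bp (KPmove x (colB j (j + 2)).1 (colB j (j + 2)).2) a = bp x a
          ∧ bm (KPmove x (colB j (j + 2)).1 (colB j (j + 2)).2) a = bm x a := by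
        intro a ha
        obtain ⟨b, hb, -, rfl⟩ := mem_colsA.1 ha
        constructor <;> apply KPmove_of_ne <;>
          simp only [colB, ne_eq, Prod.mk.injEq, true_and] <;> omega
      have := stats_bump (φ' := bp x) (ε' := bm x)
        (φ := bp (KPmove x (colB j (j + 2)).1 (colB j (j + 2)).2))
        (ε := bm (KPmove x (colB j (j + 2)).1 (colB j (j + 2)).2)) (k := rowB (j + 1) j)
        (nodup_rowsB (j + 1)) (mem_rowsB.2 ⟨j, by omega, rfl⟩)
        (Or.inr ⟨by
          symm; apply KPmove_of_ne <;> simp only [rowB, colB, ne_eq, Prod.mk.injEq, true_and] <;> omega, by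
          simp only [bm, rowB, colB]
          rw [KPmove_right (by simp)]⟩) (by
          intro a ha hak
          obtain ⟨h', hb, rfl⟩ := mem_rowsB.1 ha
          simp only [rowB, ne_eq, Prod.mk.injEq, and_true] at hak
          constructor <;> symm <;> apply KPmove_of_ne <;>
            simp only [colB, rowB, ne_eq, Prod.mk.injEq, and_true] <;> omega)
      rw [lmi_congr hA, lpl_congr hA]
      simp only [ET] at ht ⊢
      omega
    · have e1 : KPmove x (colB j b).1 (colB j b).2 (j + 1, j + 1 + 1) = x (j + 1, j + 1 + 1) := by
        apply KPmove_of_ne <;> simp only [colB, ne_eq, Prod.mk.injEq, true_and] <;> omega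
      have hB : ∀ a ∈ rowsB (j + 1), bp (KPmove x (colB j b).1 (colB j b).2) a = bp x a ∧
            bm (KPmove x (colB j b).1 (colB j b).2) a = bm x a := by
        intro a ha
        obtain ⟨b, hb, rfl⟩ := mem_rowsB.1 ha
        constructor <;> apply KPmove_of_ne <;>
          simp only [rowB, colB, ne_eq, Prod.mk.injEq] <;> omega
      have := stats_bump (φ := bp x) (ε := bm x)
        (φ' := bp (KPmove x (colB j b).1 (colB j b).2))
        (ε' := bm (KPmove x (colB j b).1 (colB j b).2)) (k := colB (j + 1) b)
        (nodup_colsA n (j + 1)) (mem_colsA.2 ⟨b, by omega, by omega, rfl⟩)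
        (Or.inr ⟨by apply KPmove_of_ne <;> simp only [colB, ne_eq, Prod.mk.injEq, and_true] <;> omega, by
          simp only [bm, colB] at hpos ⊢
          rw [KPmove_left (by simp)]; omega⟩) (by
          intro a ha hak
          obtain ⟨h', hb, -, rfl⟩ := mem_colsA.1 ha
          simp only [colB, ne_eq, Prod.mk.injEq, true_and] at hak
          constructor <;> apply KPmove_of_ne <;>
            simp only [colB, ne_eq, Prod.mk.injEq, true_and] <;> omega)
      rw [e1, lmi_congr hB, lpl_congr hB]
      simp only [ET] at ht ⊢
      omega

/-- A neighbouring `f_j` lowers the number of possible applications of `e_i` by at most one. -/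
theorem itr_eop_of_itr_fop {n i j : ℕ} (hi : 1 ≤ i) (hi2 : i + 1 ≤ n) (hj : 1 ≤ j)
    (hj2 : j + 1 ≤ n) (hij : j = i + 1 ∨ i = j + 1) {m t : ℕ} {x y : KPf} (hx : IsKP n x)
    (h : itr (fop n j) m x = some y) (ht : itr (eop n i) (t + m) x ≠ none) :
    itr (eop n i) t y ≠ none := by
  induction m generalizing x with
  | zero => cases h; exact ht
  | succ m ih =>
    rw [itr, Option.bind_eq_some_iff] at h
    obtain ⟨z, hz, h⟩ := h
    refine ih (isKP_of_fop hj hj2 hx hz) h ?_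
    rcases hij with rfl | rfl
    · exact itr_eop_of_fop_succ hi hj2 hx hz ht
    · exact itr_eop_of_fop_pred hj hi2 hx hz ht


/-! ### Commutation of distant operators -/

theorem fpos_congr {A : Type*} {φ ε φ' ε' : A → ℕ} {l : List A}
    (h : ∀ a ∈ l, φ' a = φ a ∧ ε' a = ε a) : fpos φ' ε' l = fpos φ ε l := by
  induction l with
  | nil => rfl
  | cons a l ih =>
    simp only [List.mem_cons, forall_eq_or_imp] at h
    simp only [fpos, ih h.2, lmi_congr h.2, h.1]

/-- A change that only affects a middle chunk, keeping its statistics, keeps the chunk of the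
rightmost surviving '+'. -/
theorem fpos_middle {A : Type*} {φ ε φ' ε' : A → ℕ} {l s r : List A}
    (hl : ∀ a ∈ l, φ' a = φ a ∧ ε' a = ε a) (hr : ∀ a ∈ r, φ' a = φ a ∧ ε' a = ε a)
    (h1 : lpl φ' ε' s = lpl φ ε s) (h2 : lmi φ' ε' s = lmi φ ε s) :
    lpl φ' ε' (l ++ (s ++ r)) = lpl φ ε (l ++ (s ++ r)) ∧
    ((fpos φ' ε' (l ++ (s ++ r)) = fpos φ ε (l ++ (s ++ r)) ∧
        ∀ k, fpos φ ε (l ++ (s ++ r)) = some k → k ∈ l ∨ k ∈ r) ∨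
      (fpos φ' ε' (l ++ (s ++ r)) = fpos φ' ε' s ∧ fpos φ ε (l ++ (s ++ r)) = fpos φ ε s)) := by
  simp only [fpos_append, lpl_append, lmi_append, lpl_congr hl, lmi_congr hr,
    lpl_congr hr, h1, h2, fpos_congr hl, fpos_congr hr, true_and]
  split_ifs
  · exact Or.inl ⟨rfl, fun k hk => Or.inl (mem_of_fpos _ _ hk).1⟩
  · exact Or.inr ⟨rfl, rfl⟩
  · exact Or.inl ⟨rfl, fun k hk => Or.inr (mem_of_fpos _ _ hk).1⟩

theorem range_split {n j : ℕ} (hj : j + 1 ≤ n) : List.range (n + 1) =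
    List.range j ++ ([j, j + 1] ++ List.range' (j + 2) (n - j - 1)) := by
  have h1 : [j, j + 1] ++ List.range' (j + 2) (n - j - 1) =
      List.range' (0 + j) (n - j - 1 + 1 + 1) := by
    rw [List.range'_succ, List.range'_succ, Nat.zero_add]; rfl
  rw [h1, List.range_eq_range', List.range_eq_range', List.range'_append_1]
  congr 1; omega

/-- The common chunk of `W_i*` and `W_j`, as part of `W_i*`. -/
def pairC (i j : ℕ) : List Blk := [colB i (j + 1), colB i j]

/-- The common chunk of `W_i*` and `W_j`, as part of `W_j`. -/
def pairR (i j : ℕ) : List Blk := [rowB j i, rowB j (i + 1)]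

theorem far_row {n i j : ℕ} (hij : i + 2 ≤ j) {k a : Blk} (hk : Good n i k)
    (ha : a ∈ blks n j) (h : k ∉ pairC i j ∨ a ∉ pairR i j) (x : KPf) :
    bp (KPmove x k.1 k.2) a = bp x a ∧ bm (KPmove x k.1 k.2) a = bm x a := by
  have : a.1 ≠ k.1 ∧ a.1 ≠ k.2 ∧ a.2 ≠ k.1 ∧ a.2 ≠ k.2 := by
    rw [mem_blks] at ha
    rcases hk with ⟨h, h1, h2, rfl⟩ | ⟨h, h1, h2, rfl⟩ <;>
    rcases ha with ⟨b, h3, rfl⟩ | ⟨b, h3, rfl⟩ <;>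
    simp only [pairC, pairR, List.mem_cons, List.not_mem_nil, or_false,
      rowB, colB, ne_eq, Prod.mk.injEq, true_and, and_true] at h ⊢ <;> omega
  obtain ⟨h1, h2, h3, h4⟩ := this
  exact ⟨KPmove_of_ne h1 h2, KPmove_of_ne h3 h4⟩

theorem far_col {n i j : ℕ} (hij : i + 2 ≤ j) {k a : Blk} (hk : Good n j k)
    (ha : a ∈ blks n i) (h : k ∉ pairR i j ∨ a ∉ pairC i j) (x : KPf) :
    bp (KPmove x k.1 k.2) a = bp x a ∧ bm (KPmove x k.1 k.2) a = bm x a := by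
  have : a.1 ≠ k.1 ∧ a.1 ≠ k.2 ∧ a.2 ≠ k.1 ∧ a.2 ≠ k.2 := by
    rw [mem_blks] at ha
    rcases hk with ⟨h, h1, h2, rfl⟩ | ⟨h, h1, h2, rfl⟩ <;>
    rcases ha with ⟨b, h3, rfl⟩ | ⟨b, h3, rfl⟩ <;>
    simp only [pairC, pairR, List.mem_cons, List.not_mem_nil, or_false,
      rowB, colB, ne_eq, Prod.mk.injEq, true_and, and_true] at h ⊢ <;> omega
  obtain ⟨h1, h2, h3, h4⟩ := this
  exact ⟨KPmove_of_ne h1 h2, KPmove_of_ne h3 h4⟩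

theorem KPmove_comm {x : KPf} {a b c d : Root} (h1 : c ≠ a) (h2 : c ≠ b) (h3 : d ≠ a)
    (h4 : d ≠ b) : KPmove (KPmove x a b) c d = KPmove (KPmove x c d) a b := by
  funext p
  simp only [KPmove, KPadd, KPsub]
  split_ifs <;> grind

/-- Statistics of the common chunk, as part of `W_i*`. -/
theorem stats_pair_col (x : KPf) (i j : ℕ) :
    lpl (bp x) (bm x) (pairC i j) =
      x (i + 1, j) + (x (i + 1, j + 1) - x (i, j)) ∧
    lmi (bp x) (bm x) (pairC i j) =
      x (i, j + 1) + (x (i, j) - x (i + 1, j + 1)) ∧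
    fpos (bp x) (bm x) (pairC i j) =
      if x (i, j) < x (i + 1, j + 1) then some (colB i (j + 1))
      else if 0 < x (i + 1, j) then some (colB i j) else none := by
  simp only [pairC, lpl, lmi, fpos, bp, bm, colB, Nat.sub_zero, Nat.zero_sub, Nat.add_zero,
    Nat.zero_add]
  split_ifs <;> simp_all

/-- Statistics of the common chunk, as part of `W_j`. -/
theorem stats_pair_row (x : KPf) (i j : ℕ) :
    lpl (bp x) (bm x) (pairR i j) =
      x (i + 1, j) + (x (i, j) - x (i + 1, j + 1)) ∧
    lmi (bp x) (bm x) (pairR i j) =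
      x (i, j + 1) + (x (i + 1, j + 1) - x (i, j)) ∧
    fpos (bp x) (bm x) (pairR i j) =
      if x (i + 1, j + 1) < x (i, j) then some (rowB j i)
      else if 0 < x (i + 1, j) then some (rowB j (i + 1)) else none := by
  simp only [pairR, lpl, lmi, fpos, bp, bm, rowB, Nat.sub_zero, Nat.zero_sub, Nat.add_zero,
    Nat.zero_add]
  split_ifs <;> simp_all

/-- A move changes the four entries of the common chunk as expected. -/
theorem move_col_succ (x : KPf) (i j : ℕ) (y : KPf)
    (hy : y = KPmove x (colB i (j + 1)).1 (colB i (j + 1)).2) :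
    y (i + 1, j) = x (i + 1, j) ∧ y (i, j) = x (i, j) ∧
    y (i + 1, j + 1) = x (i + 1, j + 1) - 1 ∧ y (i, j + 1) = x (i, j + 1) + 1 := by
  subst hy; simp [KPmove, KPadd, KPsub, colB]

theorem move_col (x : KPf) (i j : ℕ) (y : KPf) (hy : y = KPmove x (colB i j).1 (colB i j).2) :
    y (i + 1, j) = x (i + 1, j) - 1 ∧ y (i, j) = x (i, j) + 1 ∧
    y (i + 1, j + 1) = x (i + 1, j + 1) ∧ y (i, j + 1) = x (i, j + 1) := by
  subst hy; simp [KPmove, KPadd, KPsub, colB]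

theorem move_row (x : KPf) (i j : ℕ) (y : KPf) (hy : y = KPmove x (rowB j i).1 (rowB j i).2) :
    y (i + 1, j) = x (i + 1, j) ∧ y (i, j) = x (i, j) - 1 ∧
    y (i + 1, j + 1) = x (i + 1, j + 1) ∧ y (i, j + 1) = x (i, j + 1) + 1 := by
  subst hy; simp [KPmove, KPadd, KPsub, rowB]

theorem move_row_succ (x : KPf) (i j : ℕ) (y : KPf)
    (hy : y = KPmove x (rowB j (i + 1)).1 (rowB j (i + 1)).2) :
    y (i + 1, j) = x (i + 1, j) - 1 ∧ y (i, j) = x (i, j) ∧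
    y (i + 1, j + 1) = x (i + 1, j + 1) + 1 ∧ y (i, j + 1) = x (i, j + 1) := by
  subst hy; simp [KPmove, KPadd, KPsub, rowB]

theorem blks_split_col {n i j : ℕ} (hj2 : j + 1 ≤ n) : ∃ A B,
    blks n i = A ++ (pairC i j ++ B) := by
  refine ⟨blkW n i ++ (List.range' (j + 2) (n - j - 1)).reverse.map (colB i),
    (List.range j).reverse.map (colB i), ?_⟩
  rw [blks, blkS, range_split hj2]; simp [pairC]

theorem blks_split_row {n i j : ℕ} (hi2 : i + 1 ≤ n) : ∃ A B,
    blks n j = A ++ (pairR i j ++ B) := by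
  refine ⟨(List.range i).map (rowB j), (List.range' (i + 2) (n - i - 1)).map (rowB j) ++
    blkS n j, ?_⟩
  rw [blks, blkW, range_split hi2]; simp [pairR]

theorem disjoint_middle {A : Type*} {l s r : List A} (h : (l ++ (s ++ r)).Nodup) :
    (∀ a ∈ l, a ∉ s) ∧ ∀ a ∈ r, a ∉ s := by
  rw [List.nodup_append, List.nodup_append] at h
  obtain ⟨-, ⟨-, -, h1⟩, h2⟩ := h
  exact ⟨fun a ha hs => h2 a ha a (by simp [hs]) rfl, fun a ha hs => h1 a hs a ha rfl⟩

theorem fop_col_row {n i j : ℕ} (hij : i + 2 ≤ j) (hj2 : j + 1 ≤ n) {x y : KPf} (hx : IsKP n x)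
    {k : Blk} (hk : fpos (bp x) (bm x) (blks n i) = some k) (hy : y = KPmove x k.1 k.2) :
    lpl (bp y) (bm y) (blks n j) = lpl (bp x) (bm x) (blks n j) ∧
    ((fpos (bp y) (bm y) (blks n j) = fpos (bp x) (bm x) (blks n j) ∧
      (k ∉ pairC i j ∨ ∀ k', fpos (bp x) (bm x) (blks n j) = some k' → k' ∉ pairR i j)) ∨
      (fpos (bp x) (bm x) (pairC i j) = some k ∧
        fpos (bp x) (bm x) (blks n j) = fpos (bp x) (bm x) (pairR i j) ∧
        fpos (bp y) (bm y) (blks n j) = fpos (bp y) (bm y) (pairR i j))) := by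
  subst hy
  have hg := (good_of_fpos hx hk).1
  by_cases hkp : k ∈ pairC i j
  · obtain ⟨A, B, e⟩ := blks_split_row (i := i) (j := j) (by omega : i + 1 ≤ n)
    obtain ⟨d1, d2⟩ := disjoint_middle (e ▸ nodup_blks n j)
    have hkx : fpos (bp x) (bm x) (pairC i j) = some k := by
      obtain ⟨A', B', e'⟩ := blks_split_col (n := n) (i := i) hj2
      obtain ⟨d1', d2'⟩ := disjoint_middle (e' ▸ nodup_blks n i)
      rw [e', fpos_append, fpos_append] at hk
      split_ifs at hk
      · exact absurd hkp (d1' _ (mem_of_fpos _ _ hk).1)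
      · exact hk
      · exact absurd hkp (d2' _ (mem_of_fpos _ _ hk).1)
    obtain ⟨s1, s2, s3⟩ := stats_pair_row x i j
    obtain ⟨t1, t2, t3⟩ := stats_pair_row (KPmove x k.1 k.2) i j
    have hst : lpl (bp (KPmove x k.1 k.2)) (bm (KPmove x k.1 k.2)) (pairR i j) =
        lpl (bp x) (bm x) (pairR i j) ∧
        lmi (bp (KPmove x k.1 k.2)) (bm (KPmove x k.1 k.2)) (pairR i j) =
        lmi (bp x) (bm x) (pairR i j) := by
      rw [s1, s2, t1, t2]
      rw [(stats_pair_col x i j).2.2] at hkx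
      split_ifs at hkx with h1 h2
      · cases hkx
        obtain ⟨e1, e2, e3, e4⟩ := move_col_succ x i j _ rfl
        rw [e1, e2, e3, e4]; omega
      · cases hkx
        obtain ⟨e1, e2, e3, e4⟩ := move_col x i j _ rfl
        rw [e1, e2, e3, e4]; omega
    have hA : ∀ a ∈ A, bp (KPmove x k.1 k.2) a = bp x a ∧ bm (KPmove x k.1 k.2) a = bm x a :=
      fun a ha => far_row hij hg (by rw [e]; simp [ha]) (Or.inr (d1 a ha)) x
    have hB : ∀ a ∈ B, bp (KPmove x k.1 k.2) a = bp x a ∧ bm (KPmove x k.1 k.2) a = bm x a :=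
      fun a ha => far_row hij hg (by rw [e]; simp [ha]) (Or.inr (d2 a ha)) x
    rw [e]
    obtain ⟨h1, ⟨h2, h3⟩ | h2⟩ := fpos_middle hA hB hst.1 hst.2
    · exact ⟨h1, Or.inl ⟨h2, Or.inr fun k' hk' => (h3 k' hk').elim (d1 k') (d2 k')⟩⟩
    · exact ⟨h1, Or.inr ⟨hkx, h2.2, h2.1⟩⟩
  · have h : ∀ a ∈ blks n j, bp (KPmove x k.1 k.2) a = bp x a ∧ bm (KPmove x k.1 k.2) a = bm x a :=
      fun a ha => far_row hij hg ha (Or.inl hkp) x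
    exact ⟨lpl_congr h, Or.inl ⟨fpos_congr h, Or.inl hkp⟩⟩

theorem fop_row_col {n i j : ℕ} (hij : i + 2 ≤ j) (hj2 : j + 1 ≤ n) {x y : KPf} (hx : IsKP n x)
    {k : Blk} (hk : fpos (bp x) (bm x) (blks n j) = some k) (hy : y = KPmove x k.1 k.2) :
    lpl (bp y) (bm y) (blks n i) = lpl (bp x) (bm x) (blks n i) ∧
    ((fpos (bp y) (bm y) (blks n i) = fpos (bp x) (bm x) (blks n i) ∧
      (k ∉ pairR i j ∨ ∀ k', fpos (bp x) (bm x) (blks n i) = some k' → k' ∉ pairC i j)) ∨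
      (fpos (bp x) (bm x) (pairR i j) = some k ∧
        fpos (bp x) (bm x) (blks n i) = fpos (bp x) (bm x) (pairC i j) ∧
        fpos (bp y) (bm y) (blks n i) = fpos (bp y) (bm y) (pairC i j))) := by
  subst hy
  have hg := (good_of_fpos hx hk).1
  by_cases hkp : k ∈ pairR i j
  · obtain ⟨A, B, e⟩ := blks_split_col (n := n) (i := i) hj2
    obtain ⟨d1, d2⟩ := disjoint_middle (e ▸ nodup_blks n i)
    have hkx : fpos (bp x) (bm x) (pairR i j) = some k := by
      obtain ⟨A', B', e'⟩ := blks_split_row (i := i) (j := j) (by omega : i + 1 ≤ n)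
      obtain ⟨d1', d2'⟩ := disjoint_middle (e' ▸ nodup_blks n j)
      rw [e', fpos_append, fpos_append] at hk
      split_ifs at hk
      · exact absurd hkp (d1' _ (mem_of_fpos _ _ hk).1)
      · exact hk
      · exact absurd hkp (d2' _ (mem_of_fpos _ _ hk).1)
    obtain ⟨s1, s2, s3⟩ := stats_pair_col x i j
    obtain ⟨t1, t2, t3⟩ := stats_pair_col (KPmove x k.1 k.2) i j
    have hst : lpl (bp (KPmove x k.1 k.2)) (bm (KPmove x k.1 k.2)) (pairC i j) =
        lpl (bp x) (bm x) (pairC i j) ∧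
        lmi (bp (KPmove x k.1 k.2)) (bm (KPmove x k.1 k.2)) (pairC i j) =
        lmi (bp x) (bm x) (pairC i j) := by
      rw [s1, s2, t1, t2]
      rw [(stats_pair_row x i j).2.2] at hkx
      split_ifs at hkx with h1 h2
      · cases hkx
        obtain ⟨e1, e2, e3, e4⟩ := move_row x i j _ rfl
        rw [e1, e2, e3, e4]; omega
      · cases hkx
        obtain ⟨e1, e2, e3, e4⟩ := move_row_succ x i j _ rfl
        rw [e1, e2, e3, e4]; omega
    have hA : ∀ a ∈ A, bp (KPmove x k.1 k.2) a = bp x a ∧ bm (KPmove x k.1 k.2) a = bm x a :=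
      fun a ha => far_col hij hg (by rw [e]; simp [ha]) (Or.inr (d1 a ha)) x
    have hB : ∀ a ∈ B, bp (KPmove x k.1 k.2) a = bp x a ∧ bm (KPmove x k.1 k.2) a = bm x a :=
      fun a ha => far_col hij hg (by rw [e]; simp [ha]) (Or.inr (d2 a ha)) x
    rw [e]
    obtain ⟨h1, ⟨h2, h3⟩ | h2⟩ := fpos_middle hA hB hst.1 hst.2
    · exact ⟨h1, Or.inl ⟨h2, Or.inr fun k' hk' => (h3 k' hk').elim (d1 k') (d2 k')⟩⟩
    · exact ⟨h1, Or.inr ⟨hkx, h2.2, h2.1⟩⟩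
  · have h : ∀ a ∈ blks n i, bp (KPmove x k.1 k.2) a = bp x a ∧ bm (KPmove x k.1 k.2) a = bm x a :=
      fun a ha => far_col hij hg ha (Or.inl hkp) x
    exact ⟨lpl_congr h, Or.inl ⟨fpos_congr h, Or.inl hkp⟩⟩

theorem fop_comm {n i j : ℕ} (hij : i + 2 ≤ j) (hj2 : j + 1 ≤ n) {x : KPf}
    (hx : IsKP n x) : (fop n i x).bind (fop n j) = (fop n j x).bind (fop n i) := by
  rw [fop_eq n i x, fop_eq n j x]
  cases hi : fpos (bp x) (bm x) (blks n i) with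
  | none =>
    cases hj : fpos (bp x) (bm x) (blks n j) with
    | none => rfl
    | some k' =>
      obtain ⟨h1, -⟩ := fop_row_col hij hj2 hx hj rfl
      rw [fpos_eq_none_iff] at hi
      simp only [Option.map_none, Option.bind_none, Option.map_some, Option.bind_some]
      rw [fop_eq, (fpos_eq_none_iff _ _ _).2 (h1.trans hi)]; rfl
  | some k =>
    obtain ⟨h1, h2⟩ := fop_col_row hij hj2 hx hi rfl
    cases hj : fpos (bp x) (bm x) (blks n j) with
    | none =>
      rw [fpos_eq_none_iff] at hj
      simp only [Option.map_none, Option.bind_none, Option.map_some, Option.bind_some]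
      rw [fop_eq, (fpos_eq_none_iff _ _ _).2 (h1.trans hj)]; rfl
    | some k' =>
      obtain ⟨-, h4⟩ := fop_row_col hij hj2 hx hj rfl
      obtain ⟨hg, hp⟩ := good_of_fpos hx hi
      obtain ⟨hg', hp'⟩ := good_of_fpos hx hj
      simp only [Option.map_some, Option.bind_some]
      rw [fop_eq, fop_eq]
      rw [hi] at h4
      rw [hj] at h2
      have mR : ∀ a, fpos (bp x) (bm x) (pairR i j) = some a → a ∈ pairR i j :=
        fun a ha => (mem_of_fpos _ _ ha).1
      have mC : ∀ a, fpos (bp x) (bm x) (pairC i j) = some a → a ∈ pairC i j :=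
        fun a ha => (mem_of_fpos _ _ ha).1
      by_cases hs : k ∈ pairC i j ∧ k' ∈ pairR i j
      · obtain ⟨g1, g2, g3⟩ := h2.resolve_left fun h => h.2.elim (· hs.1) fun h => h _ rfl hs.2
        obtain ⟨g4, -, g6⟩ := h4.resolve_left fun h => h.2.elim (· hs.2) fun h => h _ rfl hs.1
        rw [g3, g6, (stats_pair_row _ i j).2.2, (stats_pair_col _ i j).2.2]
        rw [(stats_pair_row _ i j).2.2] at g4
        rw [(stats_pair_col _ i j).2.2] at g1
        clear h1 h2 h4 g2 g3 g6 hi hj hg hg' hs mR mC hx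
        split_ifs at g1 with c1 c2
        · cases g1
          split_ifs at g4 with c3 c4
          · omega
          · cases g4
            obtain ⟨e1, e2, e3, e4⟩ := move_col_succ x i j _ rfl
            obtain ⟨f1, f2, f3, f4⟩ := move_row_succ x i j _ rfl
            rw [e1, e2, e3, f1, f2, f3, if_neg (by omega), if_pos c4, if_pos (by omega)]
            simp only [Option.map_some, Option.some.injEq, colB, rowB]
            funext p
            simp only [KPmove, KPadd, KPsub]
            grind
        · cases g1
          split_ifs at g4 with c3
          · cases g4
            obtain ⟨e1, e2, e3, e4⟩ := move_col x i j _ rfl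
            obtain ⟨f1, f2, f3, f4⟩ := move_row x i j _ rfl
            rw [e1, e2, e3, f1, f2, f3, if_pos (by omega), if_neg (by omega), if_pos c2]
            simp only [Option.map_some, Option.some.injEq, colB, rowB]
            funext p
            simp only [KPmove, KPadd, KPsub]
            grind
          · cases g4
            obtain ⟨e1, e2, e3, e4⟩ := move_col x i j _ rfl
            obtain ⟨f1, f2, f3, f4⟩ := move_row_succ x i j _ rfl
            rw [e1, e2, e3, f1, f2, f3, if_pos (by omega), if_pos (by omega)]
            simp only [Option.map_some, Option.some.injEq, colB, rowB]
            funext p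
            simp only [KPmove, KPadd, KPsub]
            grind
      · have e1 := (h2.resolve_right fun h => hs ⟨mC _ h.1, mR _ h.2.1.symm⟩).1
        have e2 := (h4.resolve_right fun h => hs ⟨mC _ h.2.1.symm, mR _ h.1⟩).1
        rw [e1, e2]
        have hne := hg.ne
        have hne' := hg'.ne
        have hd := far_row hij hg (mem_of_fpos _ _ hj).1
          (by by_contra hc; exact hs ⟨by tauto, by tauto⟩) (fun _ => 2)
        simp only [bp, bm] at hd
        have hd2 : ∀ r : Root, KPmove (fun _ => 2) k.1 k.2 r = 2 → r ≠ k.1 ∧ r ≠ k.2 := by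
          intro r hr
          constructor
          · rintro rfl; rw [KPmove_left hne] at hr; omega
          · rintro rfl; rw [KPmove_right hne] at hr; omega
        obtain ⟨d1, d2⟩ := hd2 _ hd.1
        obtain ⟨d3, d4⟩ := hd2 _ hd.2
        simp only [Option.map_some]
        rw [KPmove_comm d1 d2 d3 d4]


/-! ### Gelfand–Tsetlin patterns with three rows -/

/-- A triangular array with rows `(l₁, l₂, l₃)`, `(a, b)`, `(c)`. -/
structure GT where
  l₁ : ℕ
  l₂ : ℕ
  l₃ : ℕ
  a : ℕ
  b : ℕ
  c : ℕ

namespace GT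

/-- The interlacing conditions. -/
def Valid (T : GT) : Prop :=
  T.a ≤ T.l₁ ∧ T.l₂ ≤ T.a ∧ T.b ≤ T.l₂ ∧ T.l₃ ≤ T.b ∧ T.c ≤ T.a ∧ T.b ≤ T.c

/-- Number of '+' of the two colours. -/
def ph : Bool → GT → ℕ
  | false, T => T.c - T.b
  | true, T => (T.b - T.l₃) + ((T.a - T.c) - (T.l₂ - T.b))

/-- Number of '−' of the two colours. -/
def ep : Bool → GT → ℕ
  | false, T => T.a - T.c
  | true, T => (T.l₁ - T.a) + ((T.l₂ - T.b) - (T.a - T.c))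

/-- The lowering operators. -/
def low : Bool → GT → Option GT
  | false, T => if T.b < T.c then some { T with c := T.c - 1 } else none
  | true, T =>
    if T.l₂ - T.b < T.a - T.c then some { T with a := T.a - 1 }
    else if T.l₃ < T.b then some { T with b := T.b - 1 } else none

theorem itr_low_false {m : ℕ} {T : GT} (h : T.b + m ≤ T.c) :
    itr (low false) m T = some { T with c := T.c - m } := by
  induction m generalizing T with
  | zero => rfl
  | succ m ih =>
    rw [itr, low, if_pos (by omega), Option.bind_some, ih (by simp only; omega)]
    simp only [Nat.sub_sub, Nat.add_comm]

theorem itr_low_true {m : ℕ} {T : GT} (h : T.l₃ + m ≤ T.b + ((T.a - T.c) - (T.l₂ - T.b)))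
    (hT : T.Valid) :
    itr (low true) m T = some { T with
      a := T.a - min m ((T.a - T.c) - (T.l₂ - T.b))
      b := T.b - (m - ((T.a - T.c) - (T.l₂ - T.b))) } := by
  simp only [Valid] at hT
  induction m generalizing T with
  | zero => simp [itr]
  | succ m ih =>
    rw [itr, low]
    split_ifs with h1 h2
    · rw [Option.bind_some, ih (by simp only; omega) (by simp only; omega)]
      simp only [Option.some.injEq, GT.mk.injEq, true_and, and_true]
      omega
    · rw [Option.bind_some, ih (by simp only; omega) (by simp only; omega)]
      simp only [Option.some.injEq, GT.mk.injEq, true_and, and_true]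
      omega
    · omega

set_option maxHeartbeats 1000000 in
theorem verma {T : GT} (hT : T.Valid) {p q : ℕ} (hp : ep false T + p ≤ ph false T)
    (hq : ep true T + q ≤ ph true T) : ∃ U,
    ((itr (low false) p T).bind (itr (low true) (p + q))).bind (itr (low false) q) = some U ∧
    ((itr (low true) q T).bind (itr (low false) (p + q))).bind (itr (low true) p) = some U := by
  obtain ⟨l₁, l₂, l₃, a, b, c⟩ := T
  simp only [Valid, ep, ph] at hT hp hq
  rw [itr_low_false (by simp only; omega), Option.bind_some,
    itr_low_true (by simp only; omega) (by simp only [Valid]; omega), Option.bind_some,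
    itr_low_false (by simp only; omega),
    itr_low_true (by simp only; omega) (by simp only [Valid]; omega), Option.bind_some,
    itr_low_false (by simp only; omega), Option.bind_some,
    itr_low_true (by simp only; omega) (by simp only [Valid]; omega)]
  refine ⟨_, rfl, ?_⟩
  simp only [Option.some.injEq, GT.mk.injEq, true_and]
  refine ⟨?_, ?_, ?_⟩ <;> omega

end GT

/-- A row of the alphabet `{1, 2, 3}`, given by its multiplicities. -/
abbrev Row3 : Type := ℕ × ℕ × ℕ

namespace Row3

def ph : Bool → Row3 → ℕ
  | false, x => x.1
  | true, x => x.2.1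

def ep : Bool → Row3 → ℕ
  | false, x => x.2.1
  | true, x => x.2.2

def act : Bool → Row3 → Row3
  | false, x => (x.1 - 1, x.2.1 + 1, x.2.2)
  | true, x => (x.1, x.2.1 - 1, x.2.2 + 1)

end Row3

namespace GT

/-- Numbers of twos and of threes bumped from the first row by the row insertion of `x`. -/
def bump (T : GT) (x : Row3) : ℕ × ℕ :=
  (min x.1 (T.a - T.c), min (x.1 - min x.1 (T.a - T.c) + x.2.1) (T.l₁ - T.a))

/-- Row insertion of the row `x` into the semistandard tableau of `T`. -/
def ins (T : GT) (x : Row3) : GT where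
  l₁ := T.l₁ + (x.1 + x.2.1 + x.2.2) - ((bump T x).1 + (bump T x).2)
  l₂ := T.l₂ + ((bump T x).1 + (bump T x).2) - min (bump T x).1 (T.l₂ - T.b)
  l₃ := T.l₃ + min (bump T x).1 (T.l₂ - T.b)
  a := T.a + (x.1 + x.2.1) - (bump T x).1
  b := T.b + (bump T x).1
  c := T.c + x.1

theorem ins_valid {T : GT} (hT : T.Valid) (x : Row3) : (ins T x).Valid := by
  simp only [Valid, ins, bump] at hT ⊢
  omega

theorem ph_ins {T : GT} (hT : T.Valid) (x : Row3) (k : Bool) :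
    ph k (ins T x) = ph k T + (Row3.ph k x - ep k T) := by
  simp only [Valid] at hT
  cases k <;> simp only [ph, ep, ins, bump, Row3.ph] <;> omega

theorem ep_ins {T : GT} (hT : T.Valid) (x : Row3) (k : Bool) :
    ep k (ins T x) = Row3.ep k x + (ep k T - Row3.ph k x) := by
  simp only [Valid] at hT
  cases k <;> simp only [ep, ins, bump, Row3.ph, Row3.ep] <;> omega

theorem low_valid {T U : GT} (hT : T.Valid) {k : Bool} (h : low k T = some U) :
    U.Valid ∧ U.l₁ = T.l₁ ∧ U.l₂ = T.l₂ ∧ U.l₃ = T.l₃ := by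
  obtain ⟨l₁, l₂, l₃, a, b, c⟩ := T
  simp only [Valid] at hT
  cases k <;> simp only [low] at h <;> split_ifs at h <;> cases h <;>
    simp only [Valid, and_true] <;> omega

theorem low_false_of_lt {T : GT} (h : T.b < T.c) : low false T = some { T with c := T.c - 1 } :=
  if_pos h

theorem low_false_of_not_lt {T : GT} (h : ¬ T.b < T.c) : low false T = none :=
  if_neg h

theorem low_true_of_lt {T : GT} (h : T.l₂ - T.b < T.a - T.c) :
    low true T = some { T with a := T.a - 1 } :=
  if_pos h

theorem low_true_of_not_lt {T : GT} (h : ¬ T.l₂ - T.b < T.a - T.c) (h' : T.l₃ < T.b) :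
    low true T = some { T with b := T.b - 1 } :=
  (if_neg h).trans (if_pos h')

theorem low_true_eq_none {T : GT} (h : ¬ T.l₂ - T.b < T.a - T.c) (h' : ¬ T.l₃ < T.b) :
    low true T = none :=
  (if_neg h).trans (if_neg h')

theorem low_ins_false {T : GT} (hT : T.Valid) (x : Row3) :
    low false (ins T x) = if ep false T < Row3.ph false x then
      some (ins T (Row3.act false x)) else (low false T).map (ins · x) := by
  obtain ⟨l₁, l₂, l₃, a, b, c⟩ := T
  obtain ⟨x₁, x₂, x₃⟩ := x
  simp only [Valid] at hT
  by_cases h1 : ep false ⟨l₁, l₂, l₃, a, b, c⟩ < Row3.ph false (x₁, x₂, x₃)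
  · rw [if_pos h1]
    simp only [ep, Row3.ph] at h1
    rw [low_false_of_lt (by simp only [ins, bump]; omega)]
    simp only [Option.some.injEq, GT.mk.injEq, ins, bump, Row3.act]
    refine ⟨?_, ?_, ?_, ?_, ?_, ?_⟩ <;> first | trivial | omega
  · rw [if_neg h1]
    simp only [ep, Row3.ph] at h1
    by_cases h2 : b < c
    · rw [low_false_of_lt (T := ⟨l₁, l₂, l₃, a, b, c⟩) h2,
        low_false_of_lt (by simp only [ins, bump]; omega)]
      simp only [Option.map_some, Option.some.injEq, GT.mk.injEq, ins, bump]
      refine ⟨?_, ?_, ?_, ?_, ?_, ?_⟩ <;> first | trivial | omega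
    · rw [low_false_of_not_lt (T := ⟨l₁, l₂, l₃, a, b, c⟩) h2,
        low_false_of_not_lt (by simp only [ins, bump]; omega)]
      rfl

theorem low_ins_true {T : GT} (hT : T.Valid) (x : Row3) :
    low true (ins T x) = if ep true T < Row3.ph true x then
      some (ins T (Row3.act true x)) else (low true T).map (ins · x) := by
  obtain ⟨l₁, l₂, l₃, a, b, c⟩ := T
  obtain ⟨x₁, x₂, x₃⟩ := x
  simp only [Valid] at hT
  by_cases h1 : ep true ⟨l₁, l₂, l₃, a, b, c⟩ < Row3.ph true (x₁, x₂, x₃)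
  · rw [if_pos h1]
    simp only [ep, Row3.ph] at h1
    rw [low_true_of_lt (by simp only [ins, bump]; omega)]
    simp only [Option.some.injEq, GT.mk.injEq, ins, bump, Row3.act]
    refine ⟨?_, ?_, ?_, ?_, ?_, ?_⟩ <;> first | trivial | omega
  · rw [if_neg h1]
    simp only [ep, Row3.ph] at h1
    by_cases h2 : l₂ - b < a - c
    · rw [low_true_of_lt (T := ⟨l₁, l₂, l₃, a, b, c⟩) h2]
      rcases lt_or_ge x₁ (a - c) with h4 | h4
      · have hβ : min x₁ (a - c) = x₁ := by omega
        have hγ : min x₁ (a - 1 - c) = x₁ := by omega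
        have hσ : min (x₁ - x₁ + x₂) (l₁ - a) = x₂ := by omega
        have hτ : min (x₁ - x₁ + x₂) (l₁ - (a - 1)) = x₂ := by omega
        by_cases h3 : (ins ⟨l₁, l₂, l₃, a, b, c⟩ (x₁, x₂, x₃)).l₂ -
            (ins ⟨l₁, l₂, l₃, a, b, c⟩ (x₁, x₂, x₃)).b <
            (ins ⟨l₁, l₂, l₃, a, b, c⟩ (x₁, x₂, x₃)).a - (ins ⟨l₁, l₂, l₃, a, b, c⟩ (x₁, x₂, x₃)).c
        · rw [low_true_of_lt h3]
          simp only [ins, bump, hβ, hσ] at h3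
          simp only [Option.map_some, Option.some.injEq, GT.mk.injEq, ins, bump, hβ, hγ, hσ, hτ]
          refine ⟨?_, ?_, ?_, ?_, ?_, ?_⟩ <;> first | trivial | (clear hβ hγ hτ; omega)
        · rw [low_true_of_not_lt h3 (by simp only [ins, bump, hβ, hσ] at h3 ⊢; omega)]
          simp only [ins, bump, hβ, hσ] at h3
          simp only [Option.map_some, Option.some.injEq, GT.mk.injEq, ins, bump, hβ, hγ, hσ, hτ]
          refine ⟨?_, ?_, ?_, ?_, ?_, ?_⟩ <;> first | trivial | (clear hβ hγ hτ; omega)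
      · have hβ : min x₁ (a - c) = a - c := by omega
        have hγ : min x₁ (a - 1 - c) = a - 1 - c := by omega
        have hτ : min (x₁ - (a - 1 - c) + x₂) (l₁ - (a - 1)) = min (x₁ - (a - c) + x₂) (l₁ - a) + 1 := by omega
        by_cases h3 : (ins ⟨l₁, l₂, l₃, a, b, c⟩ (x₁, x₂, x₃)).l₂ -
            (ins ⟨l₁, l₂, l₃, a, b, c⟩ (x₁, x₂, x₃)).b <
            (ins ⟨l₁, l₂, l₃, a, b, c⟩ (x₁, x₂, x₃)).a - (ins ⟨l₁, l₂, l₃, a, b, c⟩ (x₁, x₂, x₃)).c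
        · rw [low_true_of_lt h3]
          simp only [ins, bump, hβ] at h3
          simp only [Option.map_some, Option.some.injEq, GT.mk.injEq, ins, bump, hβ, hγ, hτ]
          refine ⟨?_, ?_, ?_, ?_, ?_, ?_⟩ <;> first | trivial | (clear hβ hγ hτ; omega)
        · rw [low_true_of_not_lt h3 (by simp only [ins, bump, hβ] at h3 ⊢; omega)]
          simp only [ins, bump, hβ] at h3
          simp only [Option.map_some, Option.some.injEq, GT.mk.injEq, ins, bump, hβ, hγ, hτ]
          refine ⟨?_, ?_, ?_, ?_, ?_, ?_⟩ <;> first | trivial | (clear hβ hγ hτ; omega)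
    · by_cases h3 : l₃ < b
      · rw [low_true_of_not_lt (T := ⟨l₁, l₂, l₃, a, b, c⟩) h2 h3,
          low_true_of_not_lt (by simp only [ins, bump]; omega) (by simp only [ins, bump]; omega)]
        simp only [Option.map_some, Option.some.injEq, GT.mk.injEq, ins, bump]
        refine ⟨?_, ?_, ?_, ?_, ?_, ?_⟩ <;> first | trivial | omega
      · rw [low_true_eq_none (T := ⟨l₁, l₂, l₃, a, b, c⟩) h2 h3,
          low_true_eq_none (by simp only [ins, bump]; omega) (by simp only [ins, bump]; omega)]
        rfl

theorem low_ins {T : GT} (hT : T.Valid) (x : Row3) (k : Bool) :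
    low k (ins T x) = if ep k T < Row3.ph k x then some (ins T (Row3.act k x))
      else (low k T).map (ins · x) := by
  cases k
  · exact low_ins_false hT x
  · exact low_ins_true hT x

theorem ins_inj {T T' : GT} (hT : T.Valid) (hT' : T'.Valid) {x x' : Row3}
    (h1 : T.l₁ = T'.l₁) (h2 : T.l₂ = T'.l₂) (h3 : T.l₃ = T'.l₃) (h : ins T x = ins T' x') :
    T = T' ∧ x = x' := by
  obtain ⟨l₁, l₂, l₃, a, b, c⟩ := T
  obtain ⟨m₁, m₂, m₃, a', b', c'⟩ := T'
  obtain ⟨x₁, x₂, x₃⟩ := x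
  obtain ⟨y₁, y₂, y₃⟩ := x'
  simp only at h1 h2 h3
  subst h1 h2 h3
  simp only [Valid] at hT hT'
  simp only [ins, bump, GT.mk.injEq] at h
  simp only [GT.mk.injEq, Prod.mk.injEq, true_and]
  obtain ⟨e1, e2, e3, e4, e5, e6⟩ := h
  generalize hβ : min x₁ (a - c) = β at *
  generalize hβ' : min y₁ (a' - c') = β' at *
  generalize hσ : min (x₁ - β + x₂) (l₁ - a) = σ at *
  generalize hσ' : min (y₁ - β' + y₂) (l₁ - a') = σ' at *
  have hb : b = b' ∧ β = β' := by clear e1 e2 e4 e6 hσ hσ' hβ hβ'; omega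
  obtain ⟨rfl, rfl⟩ := hb
  have e7 : σ = σ' := by clear e1; omega
  have ha : a = a' := by clear e1 e2 e3; omega
  subst ha
  have hc : c = c' := by clear e1 e2 e3; omega
  subst hc
  clear e2 e3
  omega

end GT


/-! ### Verma relations for lists of rows -/

/-- The Verma relation `g₀^q g₁^(p+q) g₀^p = g₁^p g₀^(p+q) g₁^q` at the point `x`, both sides
being defined. -/
def VermaAt {X : Type*} (g₀ g₁ : X → Option X) (p q : ℕ) (x : X) : Prop :=
  ∃ x₁ x₂ y x₃ x₄, itr g₀ p x = some x₁ ∧ itr g₁ (p + q) x₁ = some x₂ ∧ itr g₀ q x₂ = some y ∧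
    itr g₁ q x = some x₃ ∧ itr g₀ (p + q) x₃ = some x₄ ∧ itr g₁ p x₄ = some y

theorem itr_lift {X Y : Type*} {g : X → Option X} {g' : Y → Option Y} {m : X → Y} {P : X → Prop}
    (hP : ∀ x y, P x → g x = some y → P y) (hm : ∀ x, P x → g' (m x) = (g x).map m) {k : ℕ} {x : X}
    (hx : P x) {z : Y} (h : itr g' k (m x) = some z) : ∃ y, itr g k x = some y ∧ m y = z ∧ P y := by
  induction k generalizing x with
  | zero => exact ⟨x, rfl, by simpa [itr] using h, hx⟩
  | succ k ih =>
    rw [itr, hm x hx] at h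
    cases hg : g x with
    | none => simp [hg] at h
    | some y =>
      rw [hg, Option.map_some, Option.bind_some] at h
      obtain ⟨u, hu, hu'⟩ := ih (hP x y hx hg) h
      exact ⟨u, by rw [itr, hg, Option.bind_some, hu], hu'⟩

theorem VermaAt.lift {X Y : Type*} {g₀ g₁ : X → Option X} {g₀' g₁' : Y → Option Y} {m : X → Y}
    {P : X → Prop} (hP₀ : ∀ x y, P x → g₀ x = some y → P y)
    (hP₁ : ∀ x y, P x → g₁ x = some y → P y) (hm₀ : ∀ x, P x → g₀' (m x) = (g₀ x).map m)
    (hm₁ : ∀ x, P x → g₁' (m x) = (g₁ x).map m) (hinj : ∀ x y, P x → P y → m x = m y → x = y)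
    {p q : ℕ} {x : X} (hx : P x) (h : VermaAt g₀' g₁' p q (m x)) : VermaAt g₀ g₁ p q x := by
  obtain ⟨z₁, z₂, z, z₃, z₄, h1, h2, h3, h4, h5, h6⟩ := h
  obtain ⟨x₁, k1, rfl, hx₁⟩ := itr_lift hP₀ hm₀ hx h1
  obtain ⟨x₂, k2, rfl, hx₂⟩ := itr_lift hP₁ hm₁ hx₁ h2
  obtain ⟨y, k3, rfl, hy⟩ := itr_lift hP₀ hm₀ hx₂ h3
  obtain ⟨x₃, k4, rfl, hx₃⟩ := itr_lift hP₁ hm₁ hx h4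
  obtain ⟨x₄, k5, rfl, hx₄⟩ := itr_lift hP₀ hm₀ hx₃ h5
  obtain ⟨y', k6, e, hy'⟩ := itr_lift hP₁ hm₁ hx₄ h6
  obtain rfl := hinj _ _ hy' hy e
  exact ⟨x₁, x₂, y', x₃, x₄, k1, k2, k3, k4, k5, k6⟩

/-- The pattern of the tableau obtained by inserting the rows, the head last. -/
def gt : List Row3 → GT
  | [] => ⟨0, 0, 0, 0, 0, 0⟩
  | x :: l => (gt l).ins x

theorem gt_valid (l : List Row3) : (gt l).Valid := by
  induction l with
  | nil => simp [gt, GT.Valid]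
  | cons x l ih => exact GT.ins_valid ih x

/-- The shapes of the intermediate tableaux. -/
def gtShapes : List Row3 → List (ℕ × ℕ × ℕ)
  | [] => []
  | _ :: l => ((gt l).l₁, (gt l).l₂, (gt l).l₃) :: gtShapes l

theorem gt_inj {l l' : List Row3} (hs : gtShapes l = gtShapes l') (h : gt l = gt l') : l = l' := by
  induction l generalizing l' with
  | nil => cases l' with
    | nil => rfl
    | cons => simp [gtShapes] at hs
  | cons x l ih => cases l' with
    | nil => simp [gtShapes] at hs
    | cons x' l' =>
      simp only [gtShapes, List.cons.injEq, Prod.mk.injEq] at hs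
      obtain ⟨e, rfl⟩ := GT.ins_inj (gt_valid l) (gt_valid l') hs.1.1 hs.1.2.1 hs.1.2.2 h
      rw [ih hs.2 e]

/-- The lowering operators on lists of rows. -/
abbrev rowLow (k : Bool) : List Row3 → Option (List Row3) :=
  lf (Row3.ph k) (Row3.ep k) (Row3.act k)

theorem stats_gt (k : Bool) (l : List Row3) :
    GT.ph k (gt l) = lpl (Row3.ph k) (Row3.ep k) l ∧
      GT.ep k (gt l) = lmi (Row3.ph k) (Row3.ep k) l := by
  induction l with
  | nil => cases k <;> simp [gt, GT.ph, GT.ep, lpl, lmi]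
  | cons x l ih =>
    rw [gt, GT.ph_ins (gt_valid l), GT.ep_ins (gt_valid l), ih.1, ih.2]
    exact ⟨rfl, rfl⟩

theorem low_gt (k : Bool) (l : List Row3) : GT.low k (gt l) = (rowLow k l).map gt := by
  induction l with
  | nil => cases k <;> rfl
  | cons x l ih =>
    rw [gt, GT.low_ins (gt_valid l), rowLow, lf, (stats_gt k l).2, ih]
    split_ifs
    · rfl
    · rw [Option.map_map, Option.map_map]
      rfl

theorem gtShapes_of_rowLow {k : Bool} {l l' : List Row3} (h : rowLow k l = some l') :
    gtShapes l' = gtShapes l := by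
  induction l generalizing l' with
  | nil => simp [rowLow, lf] at h
  | cons x l ih =>
    rw [rowLow, lf] at h
    split_ifs at h
    · obtain rfl := Option.some.inj h
      rfl
    · obtain ⟨m, hm, rfl⟩ := Option.map_eq_some_iff.1 h
      have := GT.low_valid (gt_valid l) (U := gt m) (k := k) (by rw [low_gt, rowLow, hm]; rfl)
      rw [gtShapes, gtShapes, ih hm, this.2.1, this.2.2.1, this.2.2.2]

theorem vermaAt_rowLow {l : List Row3} {p q : ℕ}
    (hp : lmi (Row3.ph false) (Row3.ep false) l + p ≤ lpl (Row3.ph false) (Row3.ep false) l)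
    (hq : lmi (Row3.ph true) (Row3.ep true) l + q ≤ lpl (Row3.ph true) (Row3.ep true) l) :
    VermaAt (rowLow false) (rowLow true) p q l := by
  refine VermaAt.lift (m := gt) (g₀' := GT.low false) (g₁' := GT.low true)
    (P := fun m => gtShapes m = gtShapes l) (fun x y hx h => (gtShapes_of_rowLow h).trans hx)
    (fun x y hx h => (gtShapes_of_rowLow h).trans hx) (fun x _ => low_gt false x)
    (fun x _ => low_gt true x) (fun x y hx hy h => gt_inj (hx.trans hy.symm) h) rfl ?_
  obtain ⟨U, h1, h2⟩ := GT.verma (gt_valid l) (p := p) (q := q)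
    (by rwa [(stats_gt false l).1, (stats_gt false l).2])
    (by rwa [(stats_gt true l).1, (stats_gt true l).2])
  obtain ⟨y, hy, hy'⟩ := Option.bind_eq_some_iff.1 h1
  obtain ⟨x, hx, hx'⟩ := Option.bind_eq_some_iff.1 hy
  obtain ⟨v, hv, hv'⟩ := Option.bind_eq_some_iff.1 h2
  obtain ⟨u, hu, hu'⟩ := Option.bind_eq_some_iff.1 hv
  exact ⟨x, y, U, u, v, hx, hx', hy', hu, hu', hv'⟩


/-! ### Kostant partitions as lists of rows -/

/-- On `P`, the map `ψ` intertwines the signature rules of the words `K` with those of rows. -/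
def Sim (P : KPf → Prop) (K : Bool → List Blk) (ψ : KPf → List Row3) : Prop :=
  ∀ x, P x → ∀ c, lmi (Row3.ph c) (Row3.ep c) (ψ x) = lmi (bp x) (bm x) (K c) ∧
    lpl (Row3.ph c) (Row3.ep c) (ψ x) = lpl (bp x) (bm x) (K c) ∧
    ∀ k, fpos (bp x) (bm x) (K c) = some k → rowLow c (ψ x) = some (ψ (KPmove x k.1 k.2))

/-- The moves of the words `K` do not change `ψ`. -/
def Fixes (P : KPf → Prop) (K : Bool → List Blk) (ψ : KPf → List Row3) : Prop :=
  ∀ x, P x → ∀ c k, fpos (bp x) (bm x) (K c) = some k → ψ (KPmove x k.1 k.2) = ψ x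

section Chunks

variable {P : KPf → Prop}

theorem Sim.append {K₂ K₁ : Bool → List Blk} {ψ₂ ψ₁ : KPf → List Row3} (h₂ : Sim P K₂ ψ₂)
    (h₁ : Sim P K₁ ψ₁) (h₂₁ : Fixes P K₂ ψ₁) (h₁₂ : Fixes P K₁ ψ₂) :
    Sim P (fun c => K₂ c ++ K₁ c) (fun x => ψ₂ x ++ ψ₁ x) := by
  intro x hx c
  obtain ⟨a2, b2, c2⟩ := h₂ x hx c
  obtain ⟨a1, b1, c1⟩ := h₁ x hx c
  refine ⟨by simp only [lmi_append, a1, a2, b2], by simp only [lpl_append, a1, b1, b2], ?_⟩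
  intro k hk
  simp only [fpos_append] at hk
  simp only [rowLow, lf_append, a1, b2]
  split_ifs at hk ⊢ with h
  · rw [h₂₁ x hx c k hk]
    simp only [rowLow] at c2
    rw [c2 k hk, Option.map_some]
  · rw [h₁₂ x hx c k hk]
    simp only [rowLow] at c1
    rw [c1 k hk, Option.map_some]

theorem Fixes.append {K₂ K₁ : Bool → List Blk} {ψ : KPf → List Row3} (h₂ : Fixes P K₂ ψ)
    (h₁ : Fixes P K₁ ψ) : Fixes P (fun c => K₂ c ++ K₁ c) ψ := by
  intro x hx c k hk
  simp only [fpos_append] at hk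
  split_ifs at hk
  · exact h₂ x hx c k hk
  · exact h₁ x hx c k hk

theorem Fixes.append_map {K : Bool → List Blk} {ψ₂ ψ₁ : KPf → List Row3} (h₂ : Fixes P K ψ₂)
    (h₁ : Fixes P K ψ₁) : Fixes P K (fun x => ψ₂ x ++ ψ₁ x) := by
  intro x hx c k hk
  simp only [h₂ x hx c k hk, h₁ x hx c k hk]

theorem sim_zero {Z : Bool → List Blk}
    (hZ : ∀ x, P x → ∀ c, ∀ k ∈ Z c, x k.1 = 0 ∧ x k.2 = 0) : Sim P Z (fun _ => []) := by
  intro x hx c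
  have h0 : lpl (bp x) (bm x) (Z c) = 0 := lpl_eq_zero (hZ x hx c)
  refine ⟨(lmi_eq_zero (hZ x hx c)).symm, h0.symm, fun k hk => ?_⟩
  rw [(fpos_eq_none_iff _ _ _).2 h0] at hk
  simp at hk

theorem fixes_zero {Z : Bool → List Blk} {ψ : KPf → List Row3}
    (hZ : ∀ x, P x → ∀ c, ∀ k ∈ Z c, x k.1 = 0 ∧ x k.2 = 0) : Fixes P Z ψ := by
  intro x hx c k hk
  rw [(fpos_eq_none_iff _ _ _).2 (lpl_eq_zero (hZ x hx c))] at hk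
  simp at hk

theorem Sim.append_zero {K Z : Bool → List Blk} {ψ : KPf → List Row3} (h : Sim P K ψ)
    (hZ : ∀ x, P x → ∀ c, ∀ k ∈ Z c, x k.1 = 0 ∧ x k.2 = 0) :
    Sim P (fun c => K c ++ Z c) ψ := by
  have := h.append (sim_zero hZ) (fun _ _ _ _ _ => rfl) (fixes_zero hZ)
  simpa only [List.append_nil] using this

theorem Sim.zero_append {K Z : Bool → List Blk} {ψ : KPf → List Row3} (h : Sim P K ψ)
    (hZ : ∀ x, P x → ∀ c, ∀ k ∈ Z c, x k.1 = 0 ∧ x k.2 = 0) :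
    Sim P (fun c => Z c ++ K c) ψ :=
  (sim_zero hZ).append h (fixes_zero hZ) (fun _ _ _ _ _ => rfl)

/-- `ψ` reads only the entries in `S`. -/
def ReadsIn (S : Set Root) (ψ : KPf → List Row3) : Prop :=
  ∀ x y : KPf, (∀ r ∈ S, x r = y r) → ψ x = ψ y

theorem ReadsIn.fixes {S : Set Root} {ψ : KPf → List Row3} {K : Bool → List Blk}
    (h : ReadsIn S ψ) (hK : ∀ c, ∀ k ∈ K c, k.1 ∉ S ∧ k.2 ∉ S) : Fixes P K ψ := by
  intro x _ c k hk
  obtain ⟨h1, h2⟩ := hK c k (mem_of_fpos _ _ hk).1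
  exact h _ _ fun r hr => KPmove_of_ne (fun e => h1 (e ▸ hr)) (fun e => h2 (e ▸ hr))

theorem ReadsIn.flatMap {S : ℕ → Set Root} {f : ℕ → KPf → List Row3} {L : List ℕ}
    (h : ∀ b ∈ L, ReadsIn (S b) (f b)) :
    ReadsIn {r | ∃ b ∈ L, r ∈ S b} (fun x => L.flatMap fun b => f b x) := by
  intro x y hxy
  exact List.flatMap_congr fun b hb => h b hb x y fun r hr => hxy r ⟨b, hb, hr⟩

theorem sim_flatMap {S : ℕ → Set Root} {f : ℕ → KPf → List Row3} {K : Bool → ℕ → Blk} {L : List ℕ}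
    (hL : L.Nodup) (hf : ∀ b ∈ L, Sim P (fun c => [K c b]) (f b))
    (hS : ∀ b ∈ L, ReadsIn (S b) (f b))
    (hK : ∀ b ∈ L, ∀ c, ∀ b' ∈ L, b' ≠ b → (K c b).1 ∉ S b' ∧ (K c b).2 ∉ S b') :
    Sim P (fun c => L.map (K c)) (fun x => L.flatMap fun b => f b x) := by
  induction L with
  | nil => exact sim_zero (by simp)
  | cons b L ih =>
    rw [List.nodup_cons] at hL
    have ih' := ih hL.2 (fun b hb => hf b (List.mem_cons_of_mem _ hb))
      (fun b hb => hS b (List.mem_cons_of_mem _ hb)) fun a ha c a' ha' =>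
        hK a (List.mem_cons_of_mem _ ha) c a' (List.mem_cons_of_mem _ ha')
    refine (hf b List.mem_cons_self).append ih'
      ((ReadsIn.flatMap fun a ha => hS a (List.mem_cons_of_mem _ ha)).fixes ?_)
      ((hS b List.mem_cons_self).fixes ?_)
    · rintro c k hk
      rw [List.mem_singleton] at hk
      subst hk
      have key := fun a ha => hK b List.mem_cons_self c a (List.mem_cons_of_mem _ ha)
        (fun e => hL.1 (e ▸ ha))
      exact ⟨fun ⟨a, ha, h⟩ => (key a ha).1 h, fun ⟨a, ha, h⟩ => (key a ha).2 h⟩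
    · rintro c k hk
      obtain ⟨a, ha, rfl⟩ := List.mem_map.1 hk
      exact hK a (List.mem_cons_of_mem _ ha) c b List.mem_cons_self (fun e => hL.1 (e ▸ ha))


/-- The two adjacent colours `j, j + 1`. -/
def col (j : ℕ) : Bool → ℕ
  | false => j
  | true => j + 1

/-- The row of the entries `(h, j), (h, j + 1), (h, j + 2)`. -/
def rowOf (j h : ℕ) (x : KPf) : List Row3 := [(x (h, j), x (h, j + 1), x (h, j + 2))]

/-- The two rows replacing the column of the entries `(j, b), (j + 1, b), (j + 2, b)`. -/
def colOf (j b : ℕ) (x : KPf) : List Row3 :=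
  [(x (j + 2, b) + x (j + 1, b), x (j, b), 0), (0, x (j + 2, b), x (j + 1, b) + x (j, b))]

/-- The rows for the part of the triangle `(j, j + 1), (j + 1, j + 2), (j, j + 2)` read by `W`. -/
def triW (j : ℕ) (x : KPf) : List Row3 :=
  [(0, x (j, j + 1), x (j, j + 2) + (x (j + 1, j + 2) - x (j, j + 1))),
    (0, 0, min (x (j, j + 1)) (x (j + 1, j + 2)))]

/-- The rows for the part of the triangle `(j, j + 1), (j + 1, j + 2), (j, j + 2)` read by
`W*`. -/
def triS (j : ℕ) (x : KPf) : List Row3 :=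
  [(x (j + 1, j + 2), x (j, j + 2) + (x (j, j + 1) - x (j + 1, j + 2)), 0),
    (0, 0, x (j + 1, j + 2) + (x (j, j + 2) + (x (j, j + 1) - x (j + 1, j + 2)))),
    (0, min (x (j, j + 1)) (x (j + 1, j + 2)), 0),
    (0, 0, min (x (j, j + 1)) (x (j + 1, j + 2)))]

theorem readsIn_rowOf (j h : ℕ) : ReadsIn {r | r.1 = h ∧ j ≤ r.2 ∧ r.2 ≤ j + 2} (rowOf j h) := by
  intro x y hxy
  rw [rowOf, rowOf, hxy (h, j) (by simp), hxy (h, j + 1) (by simp), hxy (h, j + 2) (by simp)]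

theorem readsIn_colOf (j b : ℕ) : ReadsIn {r | r.2 = b ∧ j ≤ r.1 ∧ r.1 ≤ j + 2} (colOf j b) := by
  intro x y hxy
  rw [colOf, colOf, hxy (j, b) (by simp), hxy (j + 1, b) (by simp), hxy (j + 2, b) (by simp)]

theorem readsIn_triW (j : ℕ) : ReadsIn {r | j ≤ r.1 ∧ r.2 ≤ j + 2} (triW j) := by
  intro x y hxy
  rw [triW, triW, hxy (j, j + 1) (by simp), hxy (j + 1, j + 2) (by simp),
    hxy (j, j + 2) (by simp)]

theorem readsIn_triS (j : ℕ) : ReadsIn {r | j ≤ r.1 ∧ r.2 ≤ j + 2} (triS j) := by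
  intro x y hxy
  rw [triS, triS, hxy (j, j + 1) (by simp), hxy (j + 1, j + 2) (by simp),
    hxy (j, j + 2) (by simp)]

theorem sim_rowOf (j h : ℕ) : Sim P (fun c => [rowB (col j c) h]) (rowOf j h) := by
  intro x _ c
  refine ⟨?_, ?_, fun k hk => ?_⟩
  · cases c <;> simp [rowOf, lmi, Row3.ph, Row3.ep, rowB, col, bm, bp]
  · cases c <;> simp [rowOf, lpl, lmi, Row3.ph, rowB, col, bp]
  · have hk' := mem_of_fpos _ _ hk
    simp only [List.mem_singleton] at hk'
    obtain ⟨rfl, h0⟩ := hk'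
    cases c <;> simp only [rowB, col, bp] at h0 <;>
      simp [rowOf, rowLow, lf, lmi, Row3.ph, Row3.act, rowB, col, h0, KPmove, KPadd, KPsub,
        add_assoc]

theorem sim_colOf {j b : ℕ} : Sim P (fun c => [colB (col j c) b]) (colOf j b) := by
  intro x _ c
  refine ⟨?_, ?_, fun k hk => ?_⟩
  · cases c <;> simp [colOf, lmi, Row3.ph, Row3.ep, colB, col, bm, bp]
  · cases c <;> simp [colOf, lpl, lmi, Row3.ph, Row3.ep, colB, col, bp]
  · have hk' := mem_of_fpos _ _ hk
    simp only [List.mem_singleton] at hk'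
    obtain ⟨rfl, h0⟩ := hk'
    cases c <;> simp only [colB, col, bp, add_assoc, Nat.reduceAdd] at h0 <;>
      simp [colOf, rowLow, lf, lmi, Row3.ph, Row3.ep, Row3.act, colB, col, h0, KPmove, KPadd,
        KPsub, add_assoc] <;> omega

/-- The blocks of the triangle in `W`. -/
def blkTriW (j : ℕ) (c : Bool) : List Blk := [rowB (col j c) j, rowB (col j c) (j + 1)]

/-- The blocks of the triangle in `W*`. -/
def blkTriS (j : ℕ) (c : Bool) : List Blk := [colB (col j c) (j + 2), colB (col j c) (j + 1)]

theorem fpos_blkTriW {n j : ℕ} {x : KPf} (hx : IsKP n x) {c : Bool} {k : Blk}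
    (hk : fpos (bp x) (bm x) (blkTriW j c) = some k) :
    c = true ∧ k = ((j, j + 1), (j, j + 2)) ∧ x (j + 1, j + 2) < x (j, j + 1) := by
  have z1 : x (j, j) = 0 := hx.eq_zero le_rfl
  have z2 : x (j + 1, j + 1) = 0 := hx.eq_zero le_rfl
  have z3 : x (j + 1, j) = 0 := hx.eq_zero (by omega)
  cases c <;> simp only [blkTriW, fpos, lmi, rowB, col, bp, bm, z1, z2, z3] at hk
  · simp at hk
  · split_ifs at hk with h1
    · exact ⟨rfl, (Option.some.inj hk).symm, by omega⟩
    · omega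

theorem fpos_blkTriS {n j : ℕ} {x : KPf} (hx : IsKP n x) {c : Bool} {k : Blk}
    (hk : fpos (bp x) (bm x) (blkTriS j c) = some k) :
    c = false ∧ k = ((j + 1, j + 2), (j, j + 2)) ∧ x (j, j + 1) < x (j + 1, j + 2) := by
  have z1 : x (j + 2, j + 2) = 0 := hx.eq_zero le_rfl
  have z2 : x (j + 1, j + 1) = 0 := hx.eq_zero le_rfl
  have z3 : x (j + 2, j + 1) = 0 := hx.eq_zero (by omega)
  cases c <;> simp only [blkTriS, fpos, lmi, colB, col, bp, bm, z1, z2, z3] at hk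
  · split_ifs at hk with h1
    · exact ⟨rfl, (Option.some.inj hk).symm, by omega⟩
    · omega
  · simp at hk

theorem sim_triW (n j : ℕ) : Sim (IsKP n) (blkTriW j) (triW j) := by
  intro x hx c
  have z1 : x (j, j) = 0 := hx.eq_zero le_rfl
  have z2 : x (j + 1, j + 1) = 0 := hx.eq_zero le_rfl
  have z3 : x (j + 1, j) = 0 := hx.eq_zero (by omega)
  refine ⟨?_, ?_, fun k hk => ?_⟩
  · cases c <;> simp [triW, blkTriW, lmi, Row3.ph, Row3.ep, rowB, col, bm, bp, z1, z2, z3,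
      add_assoc]
  · cases c <;> simp [triW, blkTriW, lpl, lmi, Row3.ph, Row3.ep, rowB, col, bm, bp, z1, z2, z3,
      add_assoc]
    omega
  · obtain ⟨rfl, rfl, h0⟩ := fpos_blkTriW hx hk
    have h1 : min (x (j, j + 1)) (x (j + 1, j + 2)) < x (j, j + 1) := by omega
    simp [triW, rowLow, lf, lmi, Row3.ph, Row3.ep, Row3.act, h0, KPmove, KPadd, KPsub]
    omega

theorem sim_triS (n j : ℕ) : Sim (IsKP n) (blkTriS j) (triS j) := by
  intro x hx c
  have z1 : x (j + 2, j + 2) = 0 := hx.eq_zero le_rfl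
  have z2 : x (j + 1, j + 1) = 0 := hx.eq_zero le_rfl
  have z3 : x (j + 2, j + 1) = 0 := hx.eq_zero (by omega)
  refine ⟨?_, ?_, fun k hk => ?_⟩
  · cases c <;> simp [triS, blkTriS, lmi, Row3.ph, Row3.ep, colB, col, bm, bp, z1, z2, z3]
  · cases c <;> simp [triS, blkTriS, lpl, lmi, Row3.ph, Row3.ep, colB, col, bm, bp, z1, z2, z3]
    omega
  · obtain ⟨rfl, rfl, h0⟩ := fpos_blkTriS hx hk
    simp [triS, rowLow, lf, lmi, Row3.ph, Row3.ep, Row3.act, h0, KPmove, KPadd, KPsub]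
    omega

theorem fixes_triW_triS (n j : ℕ) : Fixes (IsKP n) (blkTriW j) (triS j) := by
  intro x hx c k hk
  obtain ⟨rfl, rfl, h0⟩ := fpos_blkTriW hx hk
  simp [triS, KPmove, KPadd, KPsub]
  omega

theorem fixes_triS_triW (n j : ℕ) : Fixes (IsKP n) (blkTriS j) (triW j) := by
  intro x hx c k hk
  obtain ⟨rfl, rfl, h0⟩ := fpos_blkTriS hx hk
  simp [triW, KPmove, KPadd, KPsub]
  omega


end Chunks

/-- The columns to the right of the triangle, in the order of `W*`, last one first. -/
def farCols (n j : ℕ) : List ℕ := (List.range' (j + 3) (n - (j + 1) - 1)).reverse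

theorem mem_farCols {n j b : ℕ} : b ∈ farCols n j ↔ j + 3 ≤ b ∧ b ≤ n := by
  rw [farCols, List.mem_reverse, List.mem_range'_1]; omega

/-- The list of rows with the signatures of `W* W` for the colours `j` and `j + 1`. -/
def rowsOf (n j : ℕ) (x : KPf) : List Row3 :=
  ((List.range j).flatMap fun h => rowOf j h x) ++
    (triW j x ++ (((farCols n j).flatMap fun b => colOf j b x) ++ triS j x))

theorem blks_eq_chunks {n j : ℕ} (hj : j + 2 ≤ n) (c : Bool) :
    blks n (col j c) = (List.range j).map (fun h => rowB (col j c) h) ++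
      (blkTriW j c ++ ((List.range' (j + 2) (n - j - 1)).map (fun h => rowB (col j c) h) ++
        ((farCols n j).map (fun b => colB (col j c) b) ++
          (blkTriS j c ++ (List.range (j + 1)).reverse.map (fun b => colB (col j c) b))))) := by
  have e1 : blkW n (col j c) = (List.range j).map (fun h => rowB (col j c) h) ++
      (blkTriW j c ++ (List.range' (j + 2) (n - j - 1)).map (fun h => rowB (col j c) h)) := by
    rw [blkW, range_split (show j + 1 ≤ n by omega)]
    simp [blkTriW]
  have e2 : blkS n (col j c) = (farCols n j).map (fun b => colB (col j c) b) ++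
      (blkTriS j c ++ (List.range (j + 1)).reverse.map (fun b => colB (col j c) b)) := by
    rw [blkS, range_split (show j + 1 + 1 ≤ n by omega)]
    simp [blkTriS, farCols]
  rw [blks, e1, e2]
  simp only [List.append_assoc]

theorem col_bounds (j : ℕ) (c : Bool) : j ≤ col j c ∧ col j c ≤ j + 1 := by
  cases c <;> simp [col]

theorem sim_rowsOf {n j : ℕ} (hj : j + 2 ≤ n) :
    Sim (IsKP n) (fun c => blks n (col j c)) (rowsOf n j) := by
  have hZS : ∀ x, IsKP n x → ∀ c, ∀ k ∈ (List.range (j + 1)).reverse.map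
      (fun b => colB (col j c) b), x k.1 = 0 ∧ x k.2 = 0 := by
    intro x hx c k hk
    obtain ⟨b, hb, rfl⟩ := List.mem_map.1 hk
    rw [List.mem_reverse, List.mem_range] at hb
    have := col_bounds j c
    exact ⟨hx.eq_zero (by omega), hx.eq_zero (by omega)⟩
  have hZW : ∀ x, IsKP n x → ∀ c, ∀ k ∈ (List.range' (j + 2) (n - j - 1)).map
      (fun h => rowB (col j c) h), x k.1 = 0 ∧ x k.2 = 0 := by
    intro x hx c k hk
    obtain ⟨b, hb, rfl⟩ := List.mem_map.1 hk
    rw [List.mem_range'_1] at hb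
    have := col_bounds j c
    exact ⟨hx.eq_zero (by omega), hx.eq_zero (by omega)⟩
  have hrows : ∀ S : Set Root, (∀ r ∈ S, j ≤ r.1) → ∀ c, ∀ k ∈ (List.range j).map
      (fun h => rowB (col j c) h), k.1 ∉ S ∧ k.2 ∉ S := by
    intro S hS c k hk
    obtain ⟨h, hh, rfl⟩ := List.mem_map.1 hk
    rw [List.mem_range] at hh
    constructor <;> intro e <;> have := hS _ e <;> simp only [rowB] at this <;> omega
  have hcols : ∀ S : Set Root, (∀ r ∈ S, r.2 ≤ j + 2) → ∀ c, ∀ k ∈ (farCols n j).map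
      (fun b => colB (col j c) b), k.1 ∉ S ∧ k.2 ∉ S := by
    intro S hS c k hk
    obtain ⟨h, hh, rfl⟩ := List.mem_map.1 hk
    rw [mem_farCols] at hh
    constructor <;> intro e <;> have := hS _ e <;> simp only [colB] at this <;> omega
  have htW : ∀ c, ∀ k ∈ blkTriW j c, j ≤ k.1.1 ∧ j ≤ k.2.1 ∧ k.1.2 ≤ j + 2 ∧ k.2.2 ≤ j + 2 := by
    intro c k hk
    have := col_bounds j c
    simp only [blkTriW, List.mem_cons, List.not_mem_nil, or_false] at hk
    rcases hk with rfl | rfl <;> simp only [rowB] <;> omega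
  have htS : ∀ c, ∀ k ∈ blkTriS j c, j ≤ k.1.1 ∧ j ≤ k.2.1 ∧ k.1.2 ≤ j + 2 ∧ k.2.2 ≤ j + 2 := by
    intro c k hk
    have := col_bounds j c
    simp only [blkTriS, List.mem_cons, List.not_mem_nil, or_false] at hk
    rcases hk with rfl | rfl <;> simp only [colB] <;> omega
  have rRows := ReadsIn.flatMap (L := List.range j) fun h _ => readsIn_rowOf j h
  have rCols := ReadsIn.flatMap (L := farCols n j) fun b _ => readsIn_colOf j b
  have sRows : Sim (IsKP n) (fun c => (List.range j).map (fun h => rowB (col j c) h))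
      (fun x => (List.range j).flatMap fun h => rowOf j h x) := by
    refine sim_flatMap List.nodup_range (fun h _ => sim_rowOf j h) (fun h _ => readsIn_rowOf j h) ?_
    rintro h - c h' - hne
    exact ⟨fun e => hne e.1.symm, fun e => hne e.1.symm⟩
  have sCols : Sim (IsKP n) (fun c => (farCols n j).map (fun b => colB (col j c) b))
      (fun x => (farCols n j).flatMap fun b => colOf j b x) := by
    refine sim_flatMap (List.nodup_reverse.2 List.nodup_range') (fun b _ => sim_colOf)
      (fun b _ => readsIn_colOf j b) ?_
    rintro h - c h' - hne
    exact ⟨fun e => hne e.1.symm, fun e => hne e.1.symm⟩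
  have s1 := (sim_triS n j).append_zero hZS
  have s2 := sCols.append s1 ((readsIn_triS j).fixes (hcols _ fun r hr => hr.2))
    (Fixes.append (rCols.fixes fun c k hk => by
      have := htS c k hk
      constructor <;> rintro ⟨b, hb, h1, -⟩ <;> rw [mem_farCols] at hb <;> omega)
      (fixes_zero hZS))
  have s3 := s2.zero_append hZW
  have s4 := (sim_triW n j).append s3
    (Fixes.append_map (rCols.fixes fun c k hk => by
      have := htW c k hk
      constructor <;> rintro ⟨b, hb, h1, -⟩ <;> rw [mem_farCols] at hb <;> omega)
      (fixes_triW_triS n j))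
    ((fixes_zero hZW).append (((readsIn_triW j).fixes (hcols _ fun r hr => hr.2)).append
      ((fixes_triS_triW n j).append (fixes_zero hZS))))
  have s5 := sRows.append s4
    (Fixes.append_map ((readsIn_triW j).fixes (hrows _ fun r hr => hr.1))
      (Fixes.append_map (rCols.fixes (hrows _ fun r hr => by
        obtain ⟨b, -, hr⟩ := hr
        exact hr.2.1)) ((readsIn_triS j).fixes (hrows _ fun r hr => hr.1))))
    (rRows.fixes fun c k hk => by
      have key : j ≤ k.1.1 ∧ j ≤ k.2.1 := by
        have := col_bounds j c
        simp only [List.mem_append, List.mem_map] at hk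
        rcases hk with hk | ⟨h, hh, rfl⟩ | ⟨b, -, rfl⟩ | hk | ⟨b, -, rfl⟩
        · exact ⟨(htW c k hk).1, (htW c k hk).2.1⟩
        · rw [List.mem_range'_1] at hh
          simp only [rowB]; omega
        · simp only [colB]; omega
        · exact ⟨(htS c k hk).1, (htS c k hk).2.1⟩
        · simp only [colB]; omega
      constructor <;> rintro ⟨h, hh, h1, -⟩ <;> rw [List.mem_range] at hh <;> omega)
  have e : (fun c => blks n (col j c)) = _ := funext fun c => blks_eq_chunks hj c
  rw [e]
  exact s5

theorem rowLow_rowsOf {n j : ℕ} (hj : j + 2 ≤ n) {x : KPf} (hx : IsKP n x) (c : Bool) :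
    rowLow c (rowsOf n j x) = (fop n (col j c) x).map (rowsOf n j) := by
  obtain ⟨-, h2, h3⟩ := sim_rowsOf hj x hx c
  rw [fop_eq]
  cases hk : fpos (bp x) (bm x) (blks n (col j c)) with
  | none =>
    rw [fpos_eq_none_iff] at hk
    rw [rowLow, (lf_eq_none_iff _ _ _ _).2 (h2.trans hk)]
    rfl
  | some k => exact h3 k hk

theorem flatMap_inj {f g : ℕ → List Row3} {L : List ℕ} (hl : ∀ b ∈ L, (f b).length = (g b).length)
    (h : L.flatMap f = L.flatMap g) : ∀ b ∈ L, f b = g b := by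
  induction L with
  | nil => simp
  | cons a L ih =>
    rw [List.flatMap_cons, List.flatMap_cons] at h
    obtain ⟨h1, h2⟩ := List.append_inj h (hl a List.mem_cons_self)
    intro b hb
    rcases List.mem_cons.1 hb with rfl | hb
    · exact h1
    · exact ih (fun b hb => hl b (List.mem_cons_of_mem _ hb)) h2 b hb

theorem rowsOf_inj {n j : ℕ} {x y : KPf} (hx : IsKP n x) (hy : IsKP n y)
    (hxy : ∀ a b, (a < j ∨ j + 2 < a) → (b < j ∨ j + 2 < b) → x (a, b) = y (a, b))
    (h : rowsOf n j x = rowsOf n j y) : x = y := by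
  rw [rowsOf, rowsOf] at h
  obtain ⟨h1, h⟩ := List.append_inj h (by simp [rowOf])
  obtain ⟨h2, h⟩ := List.append_inj h (by simp [triW])
  obtain ⟨h3, h4⟩ := List.append_inj h (by simp [colOf])
  replace h1 := flatMap_inj (by simp [rowOf]) h1
  replace h3 := flatMap_inj (by simp [colOf]) h3
  simp only [triW, triS, List.cons.injEq, Prod.mk.injEq, true_and, and_true] at h2 h4
  simp only [rowOf, colOf, List.cons.injEq, Prod.mk.injEq, true_and, and_true, List.mem_range,
    mem_farCols] at h1 h3
  funext ⟨a, b⟩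
  by_cases hab : b ≤ a
  · rw [hx.eq_zero hab, hy.eq_zero hab]
  by_cases hbn : n < b
  · have : ∀ z, IsKP n z → z (a, b) = 0 := by
      intro z hz
      by_contra h0
      have := hz _ h0
      simp only [IsPos] at this; omega
    rw [this x hx, this y hy]
  by_cases ha : a < j
  · by_cases hb : b < j ∨ j + 2 < b
    · exact hxy a b (Or.inl ha) hb
    · obtain ⟨e1, e2, e3⟩ := h1 a ha
      have : b = j ∨ b = j + 1 ∨ b = j + 2 := by omega
      rcases this with rfl | rfl | rfl <;> assumption
  by_cases ha' : j + 2 < a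
  · exact hxy a b (Or.inr ha') (Or.inr (by omega))
  by_cases hb : j + 3 ≤ b
  · have := h3 b ⟨hb, by omega⟩
    have : a = j ∨ a = j + 1 ∨ a = j + 2 := by omega
    rcases this with rfl | rfl | rfl <;> omega
  · have : (a = j ∧ b = j + 1) ∨ (a = j ∧ b = j + 2) ∨ (a = j + 1 ∧ b = j + 2) := by omega
    rcases this with ⟨rfl, rfl⟩ | ⟨rfl, rfl⟩ | ⟨rfl, rfl⟩ <;> omega


/-- The Verma relation for `f_j` and `f_{j+1}` on Kostant partitions. -/
theorem vermaAt_fop {n j : ℕ} (hj : 1 ≤ j) (hj2 : j + 2 ≤ n) {x : KPf} (hx : IsKP n x) {p q : ℕ}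
    (hp : lmi (bp x) (bm x) (blks n j) + p ≤ lpl (bp x) (bm x) (blks n j))
    (hq : lmi (bp x) (bm x) (blks n (j + 1)) + q ≤ lpl (bp x) (bm x) (blks n (j + 1))) :
    VermaAt (fop n j) (fop n (j + 1)) p q x := by
  have hP : ∀ (i : ℕ) (u v : KPf), j ≤ i → i ≤ j + 1 →
      (IsKP n u ∧ ∀ a b, (a < j ∨ j + 2 < a) → (b < j ∨ j + 2 < b) → u (a, b) = x (a, b)) →
      fop n i u = some v →
      (IsKP n v ∧ ∀ a b, (a < j ∨ j + 2 < a) → (b < j ∨ j + 2 < b) → v (a, b) = x (a, b)) := by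
    rintro i u v h1 h2 ⟨hu, hux⟩ h
    refine ⟨isKP_of_fop (by omega) (by omega) hu h, fun a b ha hb => ?_⟩
    obtain ⟨k, -, hg, -, rfl⟩ := fop_eq_some hu h
    rw [← hux a b ha hb]
    rcases hg with ⟨c, -, -, rfl⟩ | ⟨c, -, -, rfl⟩ <;>
      refine KPmove_of_ne ?_ ?_ <;> simp only [rowB, colB, ne_eq, Prod.mk.injEq, not_and] <;> omega
  refine VermaAt.lift (m := rowsOf n j)
    (P := fun u => IsKP n u ∧ ∀ a b, (a < j ∨ j + 2 < a) → (b < j ∨ j + 2 < b) → u (a, b) = x (a, b))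
    (fun u v hu h => hP j u v le_rfl (by omega) hu h)
    (fun u v hu h => hP (j + 1) u v (by omega) le_rfl hu h)
    (fun u hu => rowLow_rowsOf hj2 hu.1 false) (fun u hu => rowLow_rowsOf hj2 hu.1 true)
    (fun u v hu hv h => rowsOf_inj hu.1 hv.1
      (fun a b ha hb => (hu.2 a b ha hb).trans (hv.2 a b ha hb).symm) h)
    ⟨hx, fun _ _ _ _ => rfl⟩ (vermaAt_rowLow ?_ ?_)
  · obtain ⟨h1, h2, -⟩ := sim_rowsOf hj2 x hx false
    have e : col j false = j := rfl
    simp only [e] at h1 h2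
    omega
  · obtain ⟨h1, h2, -⟩ := sim_rowsOf hj2 x hx true
    have e : col j true = j + 1 := rfl
    simp only [e] at h1 h2
    omega


/-! ### The edges of the `Φ`-graph -/

theorem extP_mul (n : ℕ) (u w : Equiv.Perm (Fin n)) (k : ℕ) :
    extP n (u * w) k = extP n u (extP n w k) := by
  unfold extP
  by_cases h : 1 ≤ k ∧ k ≤ n
  · have h2 : (w ⟨k - 1, by omega⟩ : ℕ) + 1 ≤ n := (w ⟨k - 1, by omega⟩).2
    simp [h, h2]
  · simp [h]

theorem extP_one (n k : ℕ) : extP n 1 k = k := by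
  unfold extP
  split
  · simp only [Equiv.Perm.coe_one, id_eq]; omega
  · rfl

theorem extP_sT {n j : ℕ} (hj : 1 ≤ j) (hj2 : j + 1 ≤ n) (k : ℕ) :
    extP n (sT n j) k = Equiv.swap j (j + 1) k := by
  have h : 1 ≤ j ∧ j < n := ⟨hj, hj2⟩
  unfold extP sT
  simp only [h, and_self, dif_pos]
  split
  · simp only [Equiv.swap_apply_def, Fin.mk.injEq]
    split_ifs <;> simp only <;> omega
  · rw [Equiv.swap_apply_of_ne_of_ne] <;> omega

theorem sT_inv (n j : ℕ) : (sT n j)⁻¹ = sT n j := by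
  unfold sT
  split <;> simp

theorem permAct_sT_mul {n j : ℕ} (hj : 1 ≤ j) (hj2 : j + 1 ≤ n) (w : Equiv.Perm (Fin n))
    (v : ℕ → ℤ) (k : ℕ) : permAct n (sT n j * w) v k = permAct n w v (Equiv.swap j (j + 1) k) := by
  rw [permAct, permAct, mul_inv_rev, sT_inv, extP_mul, extP_sT hj hj2]

theorem permAct_one (n : ℕ) (v : ℕ → ℤ) : permAct n 1 v = v := by
  funext k
  rw [permAct, inv_one, extP_one]

theorem sT_braid {n j : ℕ} (hj : 1 ≤ j) (hj2 : j + 2 ≤ n) :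
    sT n j * (sT n (j + 1) * sT n j) = sT n (j + 1) * (sT n j * sT n (j + 1)) := by
  have h1 : 1 ≤ j ∧ j < n := ⟨hj, by omega⟩
  have h2 : 1 ≤ j + 1 ∧ j + 1 < n := ⟨by omega, hj2⟩
  simp only [sT, h1, h2, and_self, dif_pos]
  ext k
  simp only [Equiv.Perm.mul_apply, Equiv.swap_apply_def, Fin.ext_iff]
  grind

theorem sT_comm {n i j : ℕ} (hi : 1 ≤ i) (hij : i + 2 ≤ j) (hj2 : j + 1 ≤ n) :
    sT n i * sT n j = sT n j * sT n i := by
  have h1 : 1 ≤ i ∧ i < n := ⟨hi, by omega⟩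
  have h2 : 1 ≤ j ∧ j < n := ⟨by omega, hj2⟩
  simp only [sT, h1, h2, and_self, dif_pos]
  ext k
  simp only [Equiv.Perm.mul_apply, Equiv.swap_apply_def, Fin.ext_iff]
  grind

theorem pairCo_sT_mul {n j : ℕ} (hj : 1 ≤ j) (hj2 : j + 1 ≤ n) (w : Equiv.Perm (Fin n))
    (v : ℕ → ℤ) (i : ℕ) : pairCo (permAct n (sT n j * w) v) i =
      permAct n w v (Equiv.swap j (j + 1) i) - permAct n w v (Equiv.swap j (j + 1) (i + 1)) := by
  rw [pairCo, permAct_sT_mul hj hj2, permAct_sT_mul hj hj2]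

theorem pairCo_sT_mul_self {n j : ℕ} (hj : 1 ≤ j) (hj2 : j + 1 ≤ n) (w : Equiv.Perm (Fin n))
    (v : ℕ → ℤ) : pairCo (permAct n (sT n j * w) v) j = -pairCo (permAct n w v) j := by
  rw [pairCo_sT_mul hj hj2, Equiv.swap_apply_left, Equiv.swap_apply_right, pairCo]; ring

theorem pairCo_sT_mul_adj {n i j : ℕ} (hj : 1 ≤ j) (hj2 : j + 1 ≤ n) (w : Equiv.Perm (Fin n))
    (v : ℕ → ℤ) (hij : j = i + 1 ∨ i = j + 1) : pairCo (permAct n (sT n j * w) v) i =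
      pairCo (permAct n w v) i + pairCo (permAct n w v) j := by
  rw [pairCo_sT_mul hj hj2]
  rcases hij with rfl | rfl
  · rw [Equiv.swap_apply_of_ne_of_ne (by omega) (by omega), Equiv.swap_apply_left, pairCo, pairCo]
    ring
  · rw [Equiv.swap_apply_right, Equiv.swap_apply_of_ne_of_ne (by omega) (by omega), pairCo, pairCo]
    ring

theorem pairCo_sT_mul_far {n i j : ℕ} (hj : 1 ≤ j) (hj2 : j + 1 ≤ n) (w : Equiv.Perm (Fin n))
    (v : ℕ → ℤ) (hij : j + 2 ≤ i ∨ i + 2 ≤ j) : pairCo (permAct n (sT n j * w) v) i =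
      pairCo (permAct n w v) i := by
  rw [pairCo_sT_mul hj hj2, Equiv.swap_apply_of_ne_of_ne (by omega) (by omega),
    Equiv.swap_apply_of_ne_of_ne (by omega) (by omega), pairCo]

section Graph

variable {n : ℕ} {lam mu : ℕ → ℤ} {w : Equiv.Perm (Fin n)} {x y : KPf} {i j m : ℕ}

theorem phiEdge_of_itr (h : InS n lam mu w x) (hj : 1 ≤ j) (hj2 : j + 1 ≤ n) (hm : 0 < m)
    (hk : pairCo (permAct n w (lamRho n lam)) j = -m) (hy : itr (fop n j) m x = some y) :
    PhiEdge n lam mu (w, x) (sT n j * w, y) := by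
  refine ⟨h, ⟨itr_fop_isKP hj hj2 h.1 hy, fun k hk1 hk2 => ?_⟩, j, hj, by omega, ?_, rfl, ?_⟩
  · rw [kpEval_itr_fop hj hj2 h.1 hy, h.2 k hk1 hk2, permAct_sT_mul hj hj2, srVec]
    rw [pairCo] at hk
    by_cases h1 : k = j
    · subst h1
      rw [Equiv.swap_apply_left, if_pos rfl, if_neg (by omega)]
      linarith
    by_cases h2 : k = j + 1
    · subst h2
      rw [Equiv.swap_apply_right, if_pos rfl, if_neg (by omega)]
      linarith
    · rw [Equiv.swap_apply_of_ne_of_ne h1 h2, if_neg h1, if_neg h2]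
      ring
  · show pairCo (permAct n w (lamRho n lam)) j < 0
    omega
  · show iterO _ (-pairCo (permAct n w (lamRho n lam)) j).toNat x = some y
    rw [hk, neg_neg, Int.toNat_natCast, iterO_eq_itr, hy]

theorem lmi_add_lt_lpl (hmu : ∀ k, 1 ≤ k → k < n → mu (k + 1) ≤ mu k) (h : InS n lam mu w x)
    (hj : 1 ≤ j) (hj2 : j + 1 ≤ n) (hk : pairCo (permAct n w (lamRho n lam)) j = -m) :
    lmi (bp x) (bm x) (blks n j) + m < lpl (bp x) (bm x) (blks n j) := by
  have h1 := stats_eval hj2 x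
  rw [h.2 j hj (by omega), h.2 (j + 1) (by omega) hj2] at h1
  have h2 := hmu j hj hj2
  rw [pairCo] at hk
  simp only [rhoVec] at h1
  push_cast at h1
  omega

theorem exists_of_phiEdge {v v' : Equiv.Perm (Fin n) × KPf} (h : PhiEdge n lam mu v v') :
    ∃ j m : ℕ, 1 ≤ j ∧ j + 1 ≤ n ∧ 0 < m ∧
      pairCo (permAct n v.1 (lamRho n lam)) j = -m ∧ v'.1 = sT n j * v.1 ∧
      itr (fop n j) m v.2 = some v'.2 := by
  obtain ⟨-, -, j, hj, hj2, hk, hw, hy⟩ := h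
  refine ⟨j, _, hj, by omega, ?_, ?_, hw, (iterO_eq_itr _ _ _).symm.trans hy⟩ <;> omega

/-- Two edges leaving a vertex can be completed to a square or a hexagon. -/
theorem phiEdge_join (hmu : ∀ k, 1 ≤ k → k < n → mu (k + 1) ≤ mu k)
    {a b c : Equiv.Perm (Fin n) × KPf} (hb : PhiEdge n lam mu a b) (hc : PhiEdge n lam mu a c) :
    Relation.Join (Relation.ReflTransGen (PhiEdge n lam mu)) b c := by
  obtain ⟨i, p, hi, hi2, hp, hkp, hwb, hyb⟩ := exists_of_phiEdge hb
  obtain ⟨j, q, hj, hj2, hq, hkq, hwc, hyc⟩ := exists_of_phiEdge hc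
  wlog hij : i ≤ j generalizing b c i j p q
  · obtain ⟨d, h1, h2⟩ := this hc hb j q hj hj2 hq hkq hwc hyc i p hi hi2 hp hkp hwb hyb (by omega)
    exact ⟨d, h2, h1⟩
  obtain ⟨w, x⟩ := a
  obtain ⟨wb, xb⟩ := b
  obtain ⟨wc, xc⟩ := c
  simp only at hkp hkq hwb hwc hyb hyc
  subst hwb hwc
  have hx := hb.1
  rcases hij.eq_or_lt with rfl | hij
  · have : p = q := by omega
    subst this
    rw [hyb] at hyc
    cases hyc
    exact ⟨_, .refl, .refl⟩
  rcases (Nat.succ_le_of_lt hij).eq_or_lt with rfl | hij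
  · have h1 := lmi_add_lt_lpl hmu hx hi hi2 hkp
    have h2 := lmi_add_lt_lpl hmu hx hj hj2 hkq
    obtain ⟨x₁, x₂, y, x₃, x₄, e1, e2, e3, e4, e5, e6⟩ := vermaAt_fop hi hj2 hx.1 h1.le h2.le
    rw [hyb] at e1
    cases e1
    rw [show i.succ = i + 1 from rfl] at *
    rw [hyc] at e4
    cases e4
    have f2 : PhiEdge n lam mu (sT n i * w, xb) (sT n (i + 1) * (sT n i * w), x₂) := by
      refine phiEdge_of_itr hb.2.1 hj hj2 (by omega) ?_ e2
      rw [pairCo_sT_mul_adj hi hi2 _ _ (Or.inr rfl), hkp, hkq]; push_cast; ring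
    have f3 : PhiEdge n lam mu (sT n (i + 1) * (sT n i * w), x₂)
        (sT n i * (sT n (i + 1) * (sT n i * w)), y) := by
      refine phiEdge_of_itr f2.2.1 hi hi2 hq ?_ e3
      rw [pairCo_sT_mul_adj hj hj2 _ _ (Or.inl rfl), pairCo_sT_mul_self hi hi2,
        pairCo_sT_mul_adj hi hi2 _ _ (Or.inr rfl), hkp, hkq]; ring
    have f5 : PhiEdge n lam mu (sT n (i + 1) * w, xc) (sT n i * (sT n (i + 1) * w), x₄) := by
      refine phiEdge_of_itr hc.2.1 hi hi2 (by omega) ?_ e5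
      rw [pairCo_sT_mul_adj hj hj2 _ _ (Or.inl rfl), hkp, hkq]; push_cast; ring
    have f6 : PhiEdge n lam mu (sT n i * (sT n (i + 1) * w), x₄)
        (sT n (i + 1) * (sT n i * (sT n (i + 1) * w)), y) := by
      refine phiEdge_of_itr f5.2.1 hj hj2 hp ?_ e6
      rw [pairCo_sT_mul_adj hi hi2 _ _ (Or.inr rfl), pairCo_sT_mul_self hj hj2,
        pairCo_sT_mul_adj hj hj2 _ _ (Or.inl rfl), hkp, hkq]; ring
    refine ⟨_, (Relation.ReflTransGen.single f2).tail f3, ?_⟩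
    have e : sT n i * (sT n (i + 1) * (sT n i * w)) =
        sT n (i + 1) * (sT n i * (sT n (i + 1) * w)) := by
      simpa only [mul_assoc] using congrArg (· * w) (sT_braid hi hj2)
    rw [e]
    exact (Relation.ReflTransGen.single f5).tail f6
  · have hij' : i + 2 ≤ j := hij
    have hkq' : pairCo (permAct n (sT n i * w) (lamRho n lam)) j = -q := by
      rw [pairCo_sT_mul_far hi hi2 _ _ (Or.inl hij'), hkq]
    have hkp' : pairCo (permAct n (sT n j * w) (lamRho n lam)) i = -p := by
      rw [pairCo_sT_mul_far hj hj2 _ _ (Or.inr hij'), hkp]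
    obtain ⟨y, hy⟩ := itr_fop_exists hj hj2 (k := q) hb.2.1.1
      (by have := lmi_add_lt_lpl hmu hb.2.1 hj hj2 hkq'; omega)
    have hcomm := itr_bind_comm (P := IsKP n) (fun u v hu h => isKP_of_fop hi hi2 hu h)
      (fun u v hu h => isKP_of_fop hj hj2 hu h) (fun u hu => fop_comm hij' hj2 hu) p q hx.1
    rw [hyb, hyc, Option.bind_some, Option.bind_some, hy] at hcomm
    refine ⟨_, .single (phiEdge_of_itr hb.2.1 hj hj2 hq hkq' hy), ?_⟩
    have e : sT n j * (sT n i * w) = sT n i * (sT n j * w) := by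
      simpa only [mul_assoc] using congrArg (· * w) (sT_comm hi hij' hj2).symm
    rw [e]
    exact .single (phiEdge_of_itr hc.2.1 hi hi2 hp hkp' hcomm.symm)

theorem wellFounded_phiEdge (n : ℕ) (lam mu : ℕ → ℤ) :
    WellFounded fun a b => PhiEdge n lam mu b a := by
  let M : Equiv.Perm (Fin n) → ℤ := fun w =>
    ∑ k ∈ Finset.range (n + 1), (k : ℤ) * permAct n w (lamRho n lam) k
  have hM : WellFounded (InvImage (· < ·) M) :=
    Finite.wellFounded_of_trans_of_irrefl (InvImage (· < ·) M)
  refine Subrelation.wf ?_ (InvImage.wf Prod.fst hM)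
  intro a b h
  obtain ⟨j, m, hj, hj2, hm, hk, hw, -⟩ := exists_of_phiEdge h
  show M a.1 < M b.1
  rw [hw]
  have e : M (sT n j * b.1) = ∑ k ∈ Finset.range (n + 1),
      ((Equiv.swap j (j + 1) k : ℕ) : ℤ) * permAct n b.1 (lamRho n lam) k := by
    refine Finset.sum_equiv (Equiv.swap j (j + 1)) (fun k => ?_) fun k _ => ?_
    · rw [Finset.mem_range, Finset.mem_range, Equiv.swap_apply_def]
      split_ifs <;> omega
    · rw [permAct_sT_mul hj hj2, Equiv.swap_apply_self]
  have hd : M (sT n j * b.1) - M b.1 = pairCo (permAct n b.1 (lamRho n lam)) j := by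
    rw [e, ← Finset.sum_sub_distrib, Finset.sum_eq_add_of_mem j (j + 1)
      (Finset.mem_range.2 (by omega)) (Finset.mem_range.2 (by omega)) (by omega)]
    · rw [Equiv.swap_apply_left, Equiv.swap_apply_right, pairCo]; push_cast; ring
    · rintro k - ⟨h1, h2⟩
      rw [Equiv.swap_apply_of_ne_of_ne h1 h2, sub_self]
  omega

end Graph

/-- In a terminating, locally confluent relation, everything connected to a normal form reduces to
it. -/
theorem reflTransGen_of_locallyConfluent {V : Type*} {r : V → V → Prop}
    (hwf : WellFounded fun a b => r b a)
    (hloc : ∀ a b c, r a b → r a c → Relation.Join (Relation.ReflTransGen r) b c) {t : V}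
    (ht : ∀ b, ¬ r t b) {a : V} (h : Relation.ReflTransGen (fun a b => r a b ∨ r b a) t a) :
    Relation.ReflTransGen r a t := by
  have key : ∀ v, Relation.ReflTransGen r v t → ∀ v', r v v' → Relation.ReflTransGen r v' t := by
    intro v
    have main : Relation.ReflTransGen r v t → ∀ v', Relation.ReflTransGen r v v' →
        Relation.ReflTransGen r v' t := by
      induction v using hwf.induction with
      | _ v ih =>
        intro hv v' hv'
        rcases hv'.cases_head with rfl | ⟨b, hb, hbv⟩
        · exact hv
        rcases hv.cases_head with rfl | ⟨c, hc, hct⟩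
        · exact absurd hb (ht b)
        obtain ⟨u, hu1, hu2⟩ := hloc v b c hb hc
        exact ih b hb (hu1.trans (ih c hc hct u hu2)) v' hbv
    exact fun hv v' hv' => main hv v' (.single hv')
  induction h with
  | refl => exact .refl
  | tail _ h ih =>
    rcases h with h | h
    · exact key _ ih _ h
    · exact .head h ih

/-- The vanishing of `e_i^{k_i}` propagates backwards along an edge. -/
theorem vanish_of_phiEdge {n : ℕ} {lam mu : ℕ → ℤ} {i : ℕ} (hi : 1 ≤ i) (hi2 : i + 1 ≤ n)
    {v v' : Equiv.Perm (Fin n) × KPf} (h : PhiEdge n lam mu v v')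
    (hk : 0 < pairCo (permAct n v'.1 (lamRho n lam)) i)
    (hv : itr (eop n i) (pairCo (permAct n v'.1 (lamRho n lam)) i).toNat v'.2 = none) :
    0 < pairCo (permAct n v.1 (lamRho n lam)) i ∧
      itr (eop n i) (pairCo (permAct n v.1 (lamRho n lam)) i).toNat v.2 = none := by
  obtain ⟨j, m, hj, hj2, hm, hkj, hw, hy⟩ := exists_of_phiEdge h
  have hx := h.1.1
  rw [hw] at hk hv
  by_cases hij : i = j
  · subst hij
    rw [pairCo_sT_mul_self hi hi2, hkj, neg_neg, Int.toNat_natCast,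
      itr_eop_of_fop hi hi2 hx hy] at hv
    cases hv
  by_cases hadj : j = i + 1 ∨ i = j + 1
  · rw [pairCo_sT_mul_adj hj hj2 _ _ hadj, hkj] at hk hv
    refine ⟨by omega, ?_⟩
    by_contra hne
    refine itr_eop_of_itr_fop hi hi2 hj hj2 hadj hx hy (t := _) ?_ hv
    convert hne using 2
    omega
  · have hfar : j + 2 ≤ i ∨ i + 2 ≤ j := by omega
    rw [pairCo_sT_mul_far hj hj2 _ _ hfar] at hk hv
    refine ⟨hk, ?_⟩
    by_contra hne
    obtain ⟨z, hz⟩ := Option.ne_none_iff_exists'.1 hne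
    obtain ⟨hz1, hz2⟩ := itr_fop_of_eop hi2 hx hz
    have hc : ∀ u, IsKP n u → (fop n i u).bind (fop n j) = (fop n j u).bind (fop n i) := by
      intro u hu
      rcases hfar with hfar | hfar
      · exact (fop_comm hfar hi2 hu).symm
      · exact fop_comm hfar hj2 hu
    have hcomm := itr_bind_comm (P := IsKP n) (fun u v hu h => isKP_of_fop hi hi2 hu h)
      (fun u v hu h => isKP_of_fop hj hj2 hu h) hc
      (pairCo (permAct n v.1 (lamRho n lam)) i).toNat m hz2
    rw [hz1, Option.bind_some, hy, eq_comm, Option.bind_eq_some_iff] at hcomm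
    obtain ⟨u, hu1, hu2⟩ := hcomm
    rw [itr_eop_of_fop hi hi2 (itr_fop_isKP hj hj2 hz2 hu1) hu2] at hv
    cases hv

end KFC

open KFC in
/-- If `e_i^{k_i}(α) = 0` at the source `(id,α)`, then `e_i^{k_i'}(α') = 0` at
every vertex `(w,α')` of its component with `k_i' > 0`. -/
theorem stmt3 (n : ℕ) (hn : 2 ≤ n) (lam mu : ℕ → ℤ)
    (hlam : ∀ k, 1 ≤ k → k < n → lam (k+1) ≤ lam k) (hlamn : lam n = 0)
    (hmu : ∀ k, 1 ≤ k → k < n → mu (k+1) ≤ mu k) (hmun : 0 ≤ mu n)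
    (hcomb : ∃ c : ℕ → ℕ, c 0 = 0 ∧ c n = 0 ∧
      ∀ k, 1 ≤ k → k ≤ n → lam k - mu k = (c k : ℤ) - (c (k-1) : ℤ))
    (α : KPf) (hα : InS n lam mu 1 α) (i : ℕ) (hi1 : 1 ≤ i) (hi2 : i ≤ n - 1)
    (hki : 0 < pairCo (lamRho n lam) i)
    (h0 : iterO (eop n i) (pairCo (lamRho n lam) i).toNat α = none) :
    ∀ (w : Equiv.Perm (Fin n)) (α' : KPf), Conn n lam mu (1, α) (w, α') →
      0 < pairCo (permAct n w (lamRho n lam)) i →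
      iterO (eop n i) (pairCo (permAct n w (lamRho n lam)) i).toNat α' = none := by
  have hsrc : ∀ b, ¬ PhiEdge n lam mu (1, α) b := by
    intro b hb
    obtain ⟨j, m, hj, hj2, hm, hk, -⟩ := exists_of_phiEdge hb
    have := hlam j hj (by omega)
    simp only [permAct_one, pairCo, lamRho, rhoVec] at hk
    push_cast at hk
    omega
  intro w α' hconn hk
  have hred := reflTransGen_of_locallyConfluent (wellFounded_phiEdge n lam mu)
    (fun _ _ _ hb hc => phiEdge_join hmu hb hc) hsrc hconn
  have main : ∀ v, Relation.ReflTransGen (PhiEdge n lam mu) v (1, α) →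
      0 < pairCo (permAct n v.1 (lamRho n lam)) i ∧
        itr (eop n i) (pairCo (permAct n v.1 (lamRho n lam)) i).toNat v.2 = none := by
    intro v hv
    induction hv using Relation.ReflTransGen.head_induction_on with
    | refl =>
      rw [permAct_one]
      exact ⟨hki, (iterO_eq_itr _ _ _).symm.trans h0⟩
    | head h _ ih => exact vanish_of_phiEdge hi1 (by omega) h ih.1 ih.2
  exact (iterO_eq_itr _ _ _).trans (main _ hred).2
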